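/- arXiv:1907.09599 — 4 statements merged into one kernel-verified Lean document; each statement's English description precedes it below -/
import Mathlib

section
/- Let A, B, U, V be symmetric operators in H, and set T := A + iB with dom(T) := dom(A) ∩ dom(B) and S := U + iV with dom(S) := dom(U) ∩ dom(V). Assume that one of the following holds: (i) A is selfadjoint and semibounded, and U, V are A-compact; (ii) B is selfadjoint and semibounded, and U, V are B-compact; (iii) A and B are selfadjoint and semibounded, U is A-compact and V is B-compact. Then W_e(T) = W_e(T + S), where T + S has domain dom(T) (note that in each case the relative compactness assumptions give dom(S) ⊇ dom(T)). -/
open Filter Topology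

noncomputable section

variable {H : Type*} [NormedAddCommGroup H] [InnerProductSpace ℂ H] [CompleteSpace H]

/-- A sequence in an inner product space converges weakly to zero. -/
def WeakNull {E : Type*} [NormedAddCommGroup E] [InnerProductSpace ℂ E] (x : ℕ → E) : Prop :=
  ∀ y : E, Tendsto (fun n => (inner ℂ (x n) y : ℂ)) atTop (nhds 0)

/-- The numerical range of a (possibly unbounded) linear operator `T` in `H`,
`W(T) = {⟨Tx, x⟩ : x ∈ dom T, ‖x‖ = 1}`. -/
def numRange (T : H →ₗ.[ℂ] H) : Set ℂ :=
  {z | ∃ x : T.domain, ‖(x : H)‖ = 1 ∧ (inner ℂ ((x : H)) (T x) : ℂ) = z}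

/-- The essential numerical range of a (possibly unbounded) linear operator `T` in `H`. -/
def essNumRange (T : H →ₗ.[ℂ] H) : Set ℂ :=
  {z | ∃ x : ℕ → T.domain, (∀ n, ‖((x n : H))‖ = 1) ∧
    WeakNull (fun n => ((x n : H))) ∧
    Tendsto (fun n => (inner ℂ ((x n : H)) (T (x n)) : ℂ)) atTop (nhds z)}

/-- The essential spectrum `σ_e(T)` (the version `σ_{e2}` via singular Weyl sequences). -/
def essSpec (T : H →ₗ.[ℂ] H) : Set ℂ :=
  {z | ∃ x : ℕ → T.domain, (∀ n, ‖((x n : H))‖ = 1) ∧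
    WeakNull (fun n => ((x n : H))) ∧
    Tendsto (fun n => ‖T (x n) - z • ((x n : H))‖) atTop (nhds 0)}

/-- A linear operator `S` in `H` is symmetric if `⟨Sx, y⟩ = ⟨x, Sy⟩` for all
`x, y ∈ dom S`. -/
def IsSymmetricP (S : H →ₗ.[ℂ] H) : Prop :=
  ∀ x y : S.domain, (inner ℂ (S x) ((y : H)) : ℂ) = inner ℂ ((x : H)) (S y)

/-- `S` is `T`-compact: `dom S ⊇ dom T` and every sequence `(x_n) ⊆ dom T` with
`(‖x_n‖)` and `(‖T x_n‖)` bounded has a subsequence along which `(S x_n)` converges. -/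
def RelCompactP (S T : H →ₗ.[ℂ] H) : Prop :=
  ∃ h : T.domain ≤ S.domain, ∀ x : ℕ → T.domain,
    (∃ C : ℝ, ∀ n, ‖((x n : H))‖ ≤ C) → (∃ C : ℝ, ∀ n, ‖T (x n)‖ ≤ C) →
    ∃ (φ : ℕ → ℕ) (y : H), StrictMono φ ∧
      Tendsto (fun n => S (Submodule.inclusion h (x (φ n)))) atTop (nhds y)

/-- The sum `T + S` of two linear operators in `H`, with domain `dom T ∩ dom S`. -/
def pmapAdd (T S : H →ₗ.[ℂ] H) : H →ₗ.[ℂ] H :=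
  { domain := T.domain ⊓ S.domain
    toFun := T.toFun.comp (Submodule.inclusion inf_le_left) +
      S.toFun.comp (Submodule.inclusion inf_le_right) }

/-- The operator `A + iB`, with domain `dom A ∩ dom B`. -/
def combineI (A B : H →ₗ.[ℂ] H) : H →ₗ.[ℂ] H :=
  { domain := A.domain ⊓ B.domain
    toFun := A.toFun.comp (Submodule.inclusion inf_le_left) +
      Complex.I • (B.toFun.comp (Submodule.inclusion inf_le_right)) }

/-- `A` is semibounded: `⟨Ax, x⟩ ≥ γ‖x‖²` for all `x ∈ dom A`, or
`⟨Ax, x⟩ ≤ γ‖x‖²` for all `x ∈ dom A`. -/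
def SemiboundedP (A : H →ₗ.[ℂ] H) : Prop :=
  (∃ γ : ℝ, ∀ x : A.domain, γ * ‖(x : H)‖ ^ 2 ≤ (inner ℂ ((x : H)) (A x) : ℂ).re) ∨
  (∃ γ : ℝ, ∀ x : A.domain, (inner ℂ ((x : H)) (A x) : ℂ).re ≤ γ * ‖(x : H)‖ ^ 2)

/-- `A` is selfadjoint: densely defined and `A* = A`. -/
def IsSelfAdjointP (A : H →ₗ.[ℂ] H) : Prop :=
  Dense (A.domain : Set H) ∧ A.adjoint = A

section Abstract

set_option linter.unusedSectionVars false
set_option linter.unusedSimpArgs false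

/-- Cauchy-Schwarz for the form of a nonnegative symmetric operator. -/
lemma form_cs (D : Submodule ℂ H) (L : D →ₗ[ℂ] H)
    (symL : ∀ x y : D, (inner ℂ (L x) (y : H) : ℂ) = inner ℂ (x : H) (L y))
    (pos : ∀ x : D, 0 ≤ (inner ℂ (x : H) (L x) : ℂ).re) (x y : D) :
    ‖(inner ℂ (x : H) (L y) : ℂ)‖ ^ 2 ≤
      (inner ℂ (x : H) (L x) : ℂ).re * (inner ℂ (y : H) (L y) : ℂ).re := by
  let c : PreInnerProductSpace.Core ℂ D :=
    { inner := fun x y => inner ℂ (x : H) (L y)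
      conj_inner_symm := fun x y => by
        change (starRingEnd ℂ) (inner ℂ (y : H) (L x)) = inner ℂ (x : H) (L y)
        rw [inner_conj_symm, symL]
      re_inner_nonneg := fun x => pos x
      add_left := fun x y z => by
        change (inner ℂ ((x + y : D) : H) (L z) : ℂ) = inner ℂ (x : H) (L z) + inner ℂ (y : H) (L z)
        rw [Submodule.coe_add, inner_add_left]
      smul_left := fun x y r => by
        change (inner ℂ ((r • x : D) : H) (L y) : ℂ) = (starRingEnd ℂ) r * inner ℂ (x : H) (L y)
        rw [Submodule.coe_smul, inner_smul_left] }
  have h := @InnerProductSpace.Core.inner_mul_inner_self_le ℂ D _ _ _ c x y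
  have h1 : ‖(inner ℂ (x : H) (L y) : ℂ)‖ * ‖(inner ℂ (y : H) (L x) : ℂ)‖ ≤
      (inner ℂ (x : H) (L x) : ℂ).re * (inner ℂ (y : H) (L y) : ℂ).re := h
  have h2 : ‖(inner ℂ (y : H) (L x) : ℂ)‖ = ‖(inner ℂ (x : H) (L y) : ℂ)‖ := by
    rw [← symL x y, norm_inner_symm]
  rw [h2] at h1
  rw [pow_two]; exact h1

/-- Krein's inequality. -/
lemma krein (D : Submodule ℂ H) (L U : D →ₗ[ℂ] H)
    (symL : ∀ x y : D, (inner ℂ (L x) (y : H) : ℂ) = inner ℂ (x : H) (L y))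
    (symU : ∀ x y : D, (inner ℂ (U x) (y : H) : ℂ) = inner ℂ (x : H) (U y))
    (s : ℝ) (hs : 0 < s)
    (pos : ∀ x : D, s * ‖(x : H)‖ ^ 2 ≤ (inner ℂ (x : H) (L x) : ℂ).re)
    (surj : ∀ y : H, ∃ x : D, L x = y) (δ : ℝ) (hδ : 0 < δ)
    (hU : ∀ x : D, ‖U x‖ ≤ δ * ‖L x‖) (x : D) :
    ‖(inner ℂ (x : H) (U x) : ℂ)‖ ≤ δ * (inner ℂ (x : H) (L x) : ℂ).re := by
  have pos0 : ∀ x : D, 0 ≤ (inner ℂ (x : H) (L x) : ℂ).re := fun x =>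
    le_trans (by positivity) (pos x)
  choose R hR using surj
  let X : ℕ → D := fun k => (fun y : D => R (U y))^[k] x
  have hX : ∀ k, L (X (k + 1)) = U (X k) := fun k => by
    simp only [X, Function.iterate_succ_apply', hR]
  set a : ℕ → ℝ := fun k => (inner ℂ (X k : H) (L (X k)) : ℂ).re with ha
  have a0 : ∀ k, 0 ≤ a k := fun k => pos0 _
  have conv : ∀ k, a (k + 1) ^ 2 ≤ a k * a (k + 2) := by
    intro k
    have h1 : (inner ℂ (X (k+1) : H) (L (X (k+1))) : ℂ) = inner ℂ (X k : H) (L (X (k+2))) := by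
      rw [← symL, hX k, symU, ← hX (k+1)]
    have h2 := form_cs D L symL pos0 (X k) (X (k+2))
    refine le_trans ?_ h2
    rw [← h1]
    have := Complex.abs_re_le_norm (inner ℂ (X (k+1) : H) (L (X (k+1))) : ℂ)
    rw [← sq_abs]
    exact pow_le_pow_left₀ (abs_nonneg _) this 2
  have nrm : ∀ k, ‖L (X k)‖ ≤ δ ^ k * ‖L x‖ := by
    intro k
    induction k with
    | zero => simp [X]
    | succ k ih =>
      rw [hX k]
      refine (hU _).trans ?_
      rw [pow_succ']
      nlinarith
  have nx : ∀ y : D, s * ‖(y : H)‖ ≤ ‖L y‖ := by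
    intro y
    have h1 := pos y
    have h2 : (inner ℂ (y : H) (L y) : ℂ).re ≤ ‖(y:H)‖ * ‖L y‖ := re_inner_le_norm (𝕜 := ℂ) _ _
    by_cases hy : ‖(y:H)‖ = 0
    · rw [hy]; simp
    · have : 0 < ‖(y:H)‖ := lt_of_le_of_ne (norm_nonneg _) (Ne.symm hy)
      by_contra hc
      push Not at hc
      nlinarith
  have abd : ∀ k, s * a k ≤ (δ ^ 2) ^ k * ‖L x‖ ^ 2 := by
    intro k
    have h2 : a k ≤ ‖(X k:H)‖ * ‖L (X k)‖ := re_inner_le_norm (𝕜 := ℂ) _ _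
    have h3 := nx (X k)
    have h4 := nrm k
    calc s * a k ≤ (s * ‖(X k:H)‖) * ‖L (X k)‖ := by nlinarith
      _ ≤ ‖L (X k)‖ * ‖L (X k)‖ := by gcongr
      _ ≤ (δ ^ k * ‖L x‖) * (δ ^ k * ‖L x‖) := by gcongr
      _ = _ := by ring
  have key : a 1 ≤ δ ^ 2 * a 0 := by
    by_contra hc
    push Not at hc
    have ha0 : 0 < a 0 := by
      rcases (a0 0).lt_or_eq with h | h
      · exact h
      · exfalso
        have h1 := conv 0
        rw [← h] at hc h1
        simp at hc h1
        rw [h1] at hc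
        exact lt_irrefl _ hc
    set r := a 1 / a 0 with hr
    have hrδ : δ ^ 2 < r := by rw [hr, lt_div_iff₀ ha0]; exact hc
    have hrpos : 0 < r := lt_trans (by positivity) hrδ
    have step : ∀ k, 0 < a k ∧ r * a k ≤ a (k + 1) := by
      intro k
      induction k with
      | zero => exact ⟨ha0, by rw [hr]; field_simp; exact le_refl _⟩
      | succ k ih =>
        obtain ⟨h1, h2⟩ := ih
        have h3 : 0 < a (k+1) := lt_of_lt_of_le (by positivity) h2
        refine ⟨h3, ?_⟩
        have h4 := conv k
        have h5 : a k * (r * a (k+1)) ≤ a k * a (k+2) := by nlinarith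
        exact le_of_mul_le_mul_left h5 h1
    have low : ∀ k, r ^ k * a 0 ≤ a k := by
      intro k
      induction k with
      | zero => simp
      | succ k ih =>
        calc r ^ (k+1) * a 0 = r * (r ^ k * a 0) := by ring
          _ ≤ r * a k := by gcongr
          _ ≤ _ := (step k).2
    have hq : 1 < r / δ ^ 2 := by rw [lt_div_iff₀ (by positivity)]; linarith
    obtain ⟨n, hn⟩ := pow_unbounded_of_one_lt (‖L x‖ ^ 2 / (s * a 0)) hq
    rw [div_pow, div_lt_div_iff₀ (by positivity) (by positivity)] at hn
    have h1 := low n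
    have h2 := abd n
    nlinarith
  have fin := form_cs D L symL pos0 x (X 1)
  have e1 : L (X 1) = U x := hX 0
  rw [e1] at fin
  have e2 : (inner ℂ (X 1 : H) (U x) : ℂ).re = a 1 := by rw [ha, ← e1]
  rw [e2] at fin
  have e3 : (inner ℂ (x : H) (L x) : ℂ).re = a 0 := rfl
  rw [e3] at fin ⊢
  refine le_of_sq_le_sq ?_ (mul_nonneg hδ.le (a0 0))
  have := a0 0
  nlinarith

/-- The working hypotheses: `A` selfadjoint nonnegative, `U` symmetric and `A`-compact. -/
structure KSetup (D : Submodule ℂ H) (A U : D →ₗ[ℂ] H) : Prop where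
  dense : Dense (D : Set H)
  symA : ∀ x y : D, (inner ℂ (A x) (y : H) : ℂ) = inner ℂ (x : H) (A y)
  sa : ∀ y z : H, (∀ v : D, (inner ℂ (A v) y : ℂ) = inner ℂ (v : H) z) →
    ∃ x : D, (x : H) = y ∧ A x = z
  symU : ∀ x y : D, (inner ℂ (U x) (y : H) : ℂ) = inner ℂ (x : H) (U y)
  cpt : ∀ x : ℕ → D, (∃ C : ℝ, ∀ n, ‖((x n : H))‖ ≤ C) → (∃ C : ℝ, ∀ n, ‖A (x n)‖ ≤ C) →
    ∃ (φ : ℕ → ℕ) (y : H), StrictMono φ ∧ Tendsto (fun n => U (x (φ n))) atTop (nhds y)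

variable {D : Submodule ℂ H} {A U : D →ₗ[ℂ] H}

/-- shifted operator -/
def shiftOp (A : D →ₗ[ℂ] H) (s : ℝ) : D →ₗ[ℂ] H := A + (s : ℂ) • D.subtype

lemma shiftOp_apply (A : D →ₗ[ℂ] H) (s : ℝ) (x : D) :
    shiftOp A s x = A x + (s : ℂ) • (x : H) := rfl

lemma KSetup.sym_shift (h : KSetup D A U) (s : ℝ) (x y : D) :
    (inner ℂ (shiftOp A s x) (y : H) : ℂ) = inner ℂ (x : H) (shiftOp A s y) := by
  simp [shiftOp_apply, inner_add_left, inner_add_right, inner_smul_left, inner_smul_right, h.symA]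

lemma re_inner_shift (A : D →ₗ[ℂ] H) (s : ℝ) (x : D) :
    (inner ℂ (x : H) (shiftOp A s x) : ℂ).re
      = (inner ℂ (x : H) (A x) : ℂ).re + s * ‖(x : H)‖ ^ 2 := by
  rw [shiftOp_apply, inner_add_right, inner_smul_right, inner_self_eq_norm_sq_to_K,
    Complex.add_re, Complex.re_ofReal_mul]
  congr 2
  norm_cast

lemma norm_shift_sq (A : D →ₗ[ℂ] H) (s : ℝ) (x : D) :
    ‖shiftOp A s x‖ ^ 2
      = ‖A x‖ ^ 2 + 2 * s * (inner ℂ (x : H) (A x) : ℂ).re + s ^ 2 * ‖(x : H)‖ ^ 2 := by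
  rw [shiftOp_apply, @norm_add_sq ℂ, inner_smul_right, norm_smul, mul_pow]
  have : RCLike.re ((s : ℂ) * (inner ℂ (A x) (x : H) : ℂ)) = s * (inner ℂ (x : H) (A x) : ℂ).re := by
    change ((s : ℂ) * (inner ℂ (A x) (x : H) : ℂ)).re = _
    rw [Complex.re_ofReal_mul, ← inner_conj_symm, Complex.conj_re]
  rw [this]
  simp
  ring

lemma norm_le_shift (A : D →ₗ[ℂ] H) (pos : ∀ x : D, 0 ≤ (inner ℂ (x : H) (A x) : ℂ).re)
    (s : ℝ) (hs : 0 ≤ s) (x : D) : ‖A x‖ ≤ ‖shiftOp A s x‖ := by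
  have h := norm_shift_sq A s x
  have := pos x
  refine le_of_sq_le_sq ?_ (norm_nonneg _)
  rw [h]
  have : 0 ≤ 2 * s * (inner ℂ (x : H) (A x) : ℂ).re := by positivity
  nlinarith [sq_nonneg (s * ‖(x:H)‖)]

lemma norm_le_shift' (A : D →ₗ[ℂ] H) (pos : ∀ x : D, 0 ≤ (inner ℂ (x : H) (A x) : ℂ).re)
    (s : ℝ) (hs : 0 ≤ s) (x : D) : s * ‖(x : H)‖ ≤ ‖shiftOp A s x‖ := by
  have h := norm_shift_sq A s x
  have := pos x
  refine le_of_sq_le_sq ?_ (norm_nonneg _)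
  rw [h]
  have : 0 ≤ 2 * s * (inner ℂ (x : H) (A x) : ℂ).re := by positivity
  nlinarith [sq_nonneg (‖A x‖)]

lemma KSetup.surj (h : KSetup D A U) (pos : ∀ x : D, 0 ≤ (inner ℂ (x : H) (A x) : ℂ).re)
    (s : ℝ) (hs : 0 < s) (y : H) : ∃ x : D, shiftOp A s x = y := by
  set K := LinearMap.range (shiftOp A s) with hK
  have hclosed : IsClosed (K : Set H) := by
    refine IsSeqClosed.isClosed ?_
    intro u p hu hp
    choose x hx using hu
    have hc : CauchySeq (fun n => (x n : H)) := by
      have hcu := hp.cauchySeq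
      rw [Metric.cauchySeq_iff] at hcu ⊢
      intro ε hε
      obtain ⟨N, hN⟩ := hcu (s * ε) (by positivity)
      refine ⟨N, fun m hm n hn => ?_⟩
      have h1 := hN m hm n hn
      rw [dist_eq_norm] at h1 ⊢
      have h2 := norm_le_shift' A pos s hs.le (x m - x n)
      rw [map_sub, hx, hx, Submodule.coe_sub] at h2
      have h3 : s * ‖(x m : H) - x n‖ < s * ε := lt_of_le_of_lt h2 h1
      exact lt_of_mul_lt_mul_left h3 hs.le
    obtain ⟨q, hq⟩ := cauchySeq_tendsto_of_complete hc
    have hA : Tendsto (fun n => A (x n)) atTop (nhds (p - (s:ℂ) • q)) := by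
      have : (fun n => A (x n)) = fun n => u n - (s:ℂ) • (x n : H) := by
        funext n; rw [← hx n, shiftOp_apply]; simp
      rw [this]
      exact hp.sub (hq.const_smul _)
    obtain ⟨w, hw1, hw2⟩ := h.sa q (p - (s:ℂ) • q) (by
      intro v
      have t1 : Tendsto (fun n => (inner ℂ (A v) (x n : H) : ℂ)) atTop (nhds (inner ℂ (A v) q)) :=
        tendsto_const_nhds.inner hq
      have t2 : Tendsto (fun n => (inner ℂ (v : H) (A (x n)) : ℂ)) atTop
          (nhds (inner ℂ (v : H) (p - (s:ℂ) • q))) :=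
        tendsto_const_nhds.inner hA
      have : (fun n => (inner ℂ (A v) (x n : H) : ℂ)) = fun n => (inner ℂ (v : H) (A (x n)) : ℂ) := by
        funext n; exact h.symA _ _
      rw [this] at t1
      exact tendsto_nhds_unique t1 t2)
    refine ⟨w, ?_⟩
    rw [shiftOp_apply, hw1, hw2]; simp
  have : CompleteSpace K := hclosed.completeSpace_coe
  have hperp : Kᗮ = ⊥ := by
    rw [Submodule.eq_bot_iff]
    intro y hy
    rw [Submodule.mem_orthogonal] at hy
    obtain ⟨w, hw1, hw2⟩ := h.sa y (-(s:ℂ) • y) (by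
      intro v
      have := hy (shiftOp A s v) ⟨v, rfl⟩
      rw [shiftOp_apply, inner_add_left, inner_smul_left, Complex.conj_ofReal] at this
      rw [inner_smul_right]
      linear_combination this)
    have h1 := norm_le_shift' A pos s hs.le w
    have h2 : shiftOp A s w = 0 := by rw [shiftOp_apply, hw1, hw2]; simp
    rw [h2, norm_zero, hw1] at h1
    have : ‖y‖ ≤ 0 := by
      by_contra hc; push Not at hc; nlinarith
    exact norm_le_zero_iff.mp this
  have : K = ⊤ := (Submodule.orthogonal_eq_bot_iff).mp hperp
  have hy : y ∈ K := by rw [this]; trivial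
  exact hy

/-- limits of `U y_n` for weakly null `y_n` vanish. -/
lemma KSetup.lim_zero (h : KSetup D A U) (y : ℕ → D) (hw : WeakNull (fun n => (y n : H)))
    (z : H) (hz : Tendsto (fun n => U (y n)) atTop (nhds z)) : z = 0 := by
  refine h.dense.eq_zero_of_inner_left ℂ ?_
  intro vv hvv
  obtain ⟨v, rfl⟩ : ∃ v : D, (v : H) = vv := ⟨⟨vv, hvv⟩, rfl⟩
  have t1 : Tendsto (fun n => (inner ℂ (U (y n)) (v : H) : ℂ)) atTop (nhds (inner ℂ z (v : H))) :=
    hz.inner tendsto_const_nhds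
  have t2 := hw (U v)
  have : (fun n => (inner ℂ (U (y n)) (v : H) : ℂ)) = fun n => (inner ℂ (y n : H) (U v) : ℂ) := by
    funext n; exact h.symU _ _
  rw [this] at t1
  exact tendsto_nhds_unique t1 t2

lemma KSetup.tendsto_zero (h : KSetup D A U) (y : ℕ → D) (hw : WeakNull (fun n => (y n : H)))
    (hb : ∃ C : ℝ, ∀ n, ‖((y n : H))‖ ≤ C) (hb' : ∃ C : ℝ, ∀ n, ‖A (y n)‖ ≤ C) :
    Tendsto (fun n => U (y n)) atTop (nhds 0) := by
  refine tendsto_of_subseq_tendsto ?_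
  intro ns hns
  obtain ⟨φ, z, hφ, hz⟩ := h.cpt (fun n => y (ns n)) (hb.imp fun C hC n => hC _)
    (hb'.imp fun C hC n => hC _)
  refine ⟨φ, ?_⟩
  have := h.lim_zero (fun n => y (ns (φ n)))
    (fun v => (hw v).comp (hns.comp hφ.tendsto_atTop)) z hz
  rw [this] at hz
  exact hz

/-- relative bound zero -/
lemma KSetup.relbound (h : KSetup D A U) (pos : ∀ x : D, 0 ≤ (inner ℂ (x : H) (A x) : ℂ).re)
    (δ : ℝ) (hδ : 0 < δ) : ∃ s : ℝ, 0 < s ∧ ∀ x : D, ‖U x‖ ≤ δ * ‖shiftOp A s x‖ := by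
  by_contra hc
  push Not at hc
  have hc' : ∀ n : ℕ, ∃ x : D, ‖shiftOp A ((n:ℝ)+1) x‖ = 1 ∧ δ < ‖U x‖ := by
    intro n
    have hn : (0:ℝ) < (n:ℝ) + 1 := by positivity
    obtain ⟨x, hx⟩ := hc ((n:ℝ)+1) hn
    set c := ‖shiftOp A ((n:ℝ)+1) x‖ with hcdef
    have hc0 : 0 < c := by
      rcases (norm_nonneg (shiftOp A ((n:ℝ)+1) x)).lt_or_eq with h1 | h1
      · exact h1
      · exfalso
        have h2 := norm_le_shift' A pos ((n:ℝ)+1) hn.le x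
        rw [← h1] at h2
        have : ‖(x:H)‖ ≤ 0 := by by_contra hcc; push Not at hcc; nlinarith
        have hx0 : x = 0 := by
          apply Subtype.ext; simpa using this
        rw [hx0] at hx
        simp at hx
        have : 0 ≤ δ * c := by positivity
        linarith
    refine ⟨((c⁻¹ : ℝ) : ℂ) • x, ?_, ?_⟩
    · rw [map_smul, norm_smul, ← hcdef]
      simp [abs_of_pos hc0]
      field_simp
    · rw [map_smul, norm_smul]
      simp only [Complex.norm_real, norm_inv, Real.norm_eq_abs, abs_of_pos hc0]
      rw [inv_mul_eq_div, lt_div_iff₀ hc0]; exact hx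
  choose x hx1 hx2 using hc'
  have hx0 : Tendsto (fun n => (x n : H)) atTop (nhds 0) := by
    rw [tendsto_zero_iff_norm_tendsto_zero]
    refine squeeze_zero (fun n => norm_nonneg _) (fun n => ?_)
      (tendsto_one_div_add_atTop_nhds_zero_nat (𝕜 := ℝ))
    have hn : (0:ℝ) < (n:ℝ) + 1 := by positivity
    have h2 := norm_le_shift' A pos ((n:ℝ)+1) hn.le (x n)
    rw [hx1] at h2
    rw [le_div_iff₀ hn]; linarith
  have hw : WeakNull (fun n => (x n : H)) := by
    intro v
    have : Tendsto (fun n => (inner ℂ (x n : H) v : ℂ)) atTop (nhds (inner ℂ (0:H) v)) :=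
      hx0.inner tendsto_const_nhds
    simpa using this
  have hb := hx0.norm.bddAbove_range
  obtain ⟨C, hC⟩ := hb
  have t := h.tendsto_zero x hw ⟨C, fun n => hC ⟨n, rfl⟩⟩ ⟨1, fun n => by
    have hn : (0:ℝ) < (n:ℝ) + 1 := by positivity
    have := norm_le_shift A pos ((n:ℝ)+1) hn.le (x n)
    rw [hx1] at this; exact this⟩
  have t' := t.norm
  rw [norm_zero] at t'
  have := ge_of_tendsto' t' (fun n => (hx2 n).le)
  linarith

lemma KSetup.formbound (h : KSetup D A U) (pos : ∀ x : D, 0 ≤ (inner ℂ (x : H) (A x) : ℂ).re)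
    (δ : ℝ) (hδ : 0 < δ) : ∃ s : ℝ, 0 < s ∧ ∀ x : D,
      ‖(inner ℂ (x : H) (U x) : ℂ)‖ ≤ δ * ((inner ℂ (x : H) (A x) : ℂ).re + s * ‖(x : H)‖ ^ 2) := by
  obtain ⟨s, hs, hb⟩ := h.relbound pos δ hδ
  refine ⟨s, hs, fun x => ?_⟩
  rw [← re_inner_shift]
  refine krein D (shiftOp A s) U (h.sym_shift s) h.symU s hs ?_ (h.surj pos s hs) δ hδ hb x
  intro x
  rw [re_inner_shift]
  linarith [pos x]

lemma KSetup.form_tendsto (h : KSetup D A U) (pos : ∀ x : D, 0 ≤ (inner ℂ (x : H) (A x) : ℂ).re)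
    (x : ℕ → D) (hx1 : ∀ n, ‖(x n : H)‖ = 1) (hw : WeakNull (fun n => (x n : H)))
    (C : ℝ) (hC : ∀ n, (inner ℂ (x n : H) (A (x n)) : ℂ).re ≤ C) :
    Tendsto (fun n => (inner ℂ (x n : H) (U (x n)) : ℂ)) atTop (nhds 0) := by
  have hC0 : 0 ≤ C := (pos (x 0)).trans (hC 0)
  rw [tendsto_zero_iff_norm_tendsto_zero, Metric.tendsto_atTop]
  intro ε hε
  set δ := ε / (2 * (C + 1)) with hδdef
  have hδ : 0 < δ := by positivity
  have hδC : δ * C < ε / 2 := by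
    have : δ * (C + 1) = ε / 2 := by rw [hδdef]; field_simp
    nlinarith
  obtain ⟨s, hs, hb⟩ := h.formbound pos δ hδ
  choose w hw' using fun n => h.surj pos s hs (x n : H)
  -- `z n = A (w n)`
  set y : ℕ → D := fun n => (s : ℂ) • w n with hy
  set z : ℕ → D := fun n => x n - y n with hz
  have hzA : ∀ n, (z n : H) = A (w n) := by
    intro n
    have := hw' n
    rw [shiftOp_apply] at this
    simp only [hz, hy, Submodule.coe_sub, Submodule.coe_smul]
    rw [← this]; simp
  have hyb : ∀ n, ‖(y n : H)‖ ≤ 1 := by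
    intro n
    have := norm_le_shift' A pos s hs.le (w n)
    rw [hw', hx1] at this
    simp only [hy, Submodule.coe_smul, norm_smul, Complex.norm_real, Real.norm_eq_abs, abs_of_pos hs]
    exact this
  have hzb : ∀ n, ‖(z n : H)‖ ≤ 1 := by
    intro n
    have := norm_le_shift A pos s hs.le (w n)
    rw [hw', hx1] at this
    rw [hzA]; exact this
  have hyw : WeakNull (fun n => (y n : H)) := by
    intro v
    obtain ⟨u, hu⟩ := h.surj pos s hs v
    have e : (fun n => (inner ℂ (y n : H) v : ℂ)) = fun n => (s:ℂ) * (inner ℂ (x n : H) (u : H) : ℂ) := by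
      funext n
      rw [← hu, ← h.sym_shift, hy]
      simp only [map_smul, hw', inner_smul_left, Complex.conj_ofReal]
    rw [e]
    have := (hw (u : H)).const_mul (s:ℂ)
    simpa using this
  have hUy : Tendsto (fun n => U (y n)) atTop (nhds 0) := by
    refine h.tendsto_zero y hyw ⟨1, hyb⟩ ⟨s, fun n => ?_⟩
    simp only [hy, map_smul, norm_smul, Complex.norm_real, Real.norm_eq_abs, abs_of_pos hs]
    have := hzb n
    rw [hzA] at this
    nlinarith
  have hdec : ∀ n, ‖(inner ℂ (x n : H) (U (x n)) : ℂ)‖ ≤ 2 * ‖U (y n)‖ + δ * C := by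
    intro n
    have ex : x n = y n + z n := by simp [hz]
    have e : (inner ℂ (x n : H) (U (x n)) : ℂ) =
        inner ℂ (x n : H) (U (y n)) + inner ℂ (U (y n)) (z n : H) + inner ℂ (z n : H) (U (z n)) := by
      rw [h.symU]
      have : U (x n) = U (y n) + U (z n) := by rw [← map_add, ← ex]
      have ex' : (x n : H) = y n + z n := by rw [← Submodule.coe_add, ← ex]
      rw [this, inner_add_right, add_assoc, ← inner_add_left, ← ex']
    have hz1 : (inner ℂ (z n : H) (A (z n)) : ℂ).re + s * ‖(z n : H)‖ ^ 2 ≤ C := by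
      refine le_trans ?_ (hC n)
      have ex' : (x n : H) = z n + (s:ℂ) • (w n : H) := by
        simp [hz, hy]
      have eA : A (x n) = A (z n) + (s:ℂ) • (z n : H) := by
        rw [hzA, ← map_smul, ← map_add]
        simp [hz, hy]
      have e1 : (inner ℂ (w n : H) (A (z n)) : ℂ) = inner ℂ (z n : H) (z n : H) := by
        rw [← h.symA, ← hzA]
      have e2 : (inner ℂ (x n : H) (A (x n)) : ℂ) = inner ℂ (z n : H) (A (z n))
          + (s:ℂ) * inner ℂ (z n : H) (z n : H) + (s:ℂ) * inner ℂ (z n : H) (z n : H)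
          + (s:ℂ) * ((s:ℂ) * inner ℂ (w n : H) (A (w n))) := by
        rw [eA]
        nth_rewrite 1 [ex']
        rw [inner_add_left, inner_add_right, inner_add_right, inner_smul_left, inner_smul_left,
          inner_smul_right, inner_smul_right, e1, Complex.conj_ofReal, ← hzA]
        ring
      have e3 : (inner ℂ (z n : H) (z n : H) : ℂ).re = ‖(z n : H)‖ ^ 2 := by
        rw [inner_self_eq_norm_sq_to_K]; norm_cast
      rw [e2]
      simp only [Complex.add_re, Complex.re_ofReal_mul, e3]
      have p1 : 0 ≤ s * (s * (inner ℂ (w n : H) (A (w n)) : ℂ).re) := by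
        have := pos (w n); positivity
      have p2 : 0 ≤ s * ‖(z n : H)‖ ^ 2 := by positivity
      linarith
    rw [e]
    have n1 : ‖(inner ℂ (x n : H) (U (y n)) : ℂ)‖ ≤ ‖U (y n)‖ := by
      have := norm_inner_le_norm (𝕜 := ℂ) (x n : H) (U (y n))
      rw [hx1, one_mul] at this; exact this
    have n2 : ‖(inner ℂ (U (y n)) (z n : H) : ℂ)‖ ≤ ‖U (y n)‖ := by
      have := norm_inner_le_norm (𝕜 := ℂ) (U (y n)) (z n : H)
      have h3 := hzb n
      nlinarith [norm_nonneg (U (y n))]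
    have n3 := hb (z n)
    have n4 : δ * ((inner ℂ (z n : H) (A (z n)) : ℂ).re + s * ‖(z n : H)‖ ^ 2) ≤ δ * C := by gcongr
    have := norm_add₃_le (a := (inner ℂ (x n : H) (U (y n)) : ℂ)) (b := inner ℂ (U (y n)) (z n : H))
      (c := inner ℂ (z n : H) (U (z n)))
    linarith
  rw [Metric.tendsto_atTop] at hUy
  obtain ⟨N, hN⟩ := hUy (ε / 4) (by positivity)
  refine ⟨N, fun n hn => ?_⟩
  have h1 := hN n hn
  rw [dist_zero_right] at h1
  rw [dist_zero_right, norm_norm]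
  have := hdec n
  linarith

end Abstract

section Concrete

set_option linter.unusedSectionVars false

lemma ksetup_of (A U : H →ₗ.[ℂ] H) (hA : IsSymmetricP A) (hU : IsSymmetricP U)
    (hsa : IsSelfAdjointP A) (h : A.domain ≤ U.domain)
    (hc : ∀ x : ℕ → A.domain,
    (∃ C : ℝ, ∀ n, ‖((x n : H))‖ ≤ C) → (∃ C : ℝ, ∀ n, ‖A (x n)‖ ≤ C) →
    ∃ (φ : ℕ → ℕ) (y : H), StrictMono φ ∧
      Tendsto (fun n => U (Submodule.inclusion h (x (φ n)))) atTop (nhds y))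
    (e c : ℝ) (he : e * e = 1) :
    KSetup A.domain (shiftOp ((e : ℂ) • A.toFun) c) (U.toFun.comp (Submodule.inclusion h)) := by
  have he' : (e : ℂ) * e = 1 := by exact_mod_cast he
  have hap : ∀ x : A.domain, shiftOp ((e : ℂ) • A.toFun) c x = (e : ℂ) • A x + (c : ℂ) • (x : H) :=
    fun x => rfl
  refine ⟨hsa.1, ?_, ?_, ?_, ?_⟩
  · intro x y
    rw [hap, hap, inner_add_left, inner_add_right, inner_smul_left, inner_smul_left,
      inner_smul_right, inner_smul_right, hA, Complex.conj_ofReal, Complex.conj_ofReal]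
  · intro y z hyz
    have key : ∀ v : A.domain, (inner ℂ ((e : ℂ) • (z - (c : ℂ) • y)) (v : H) : ℂ) = inner ℂ y (A v) := by
      intro v
      have h1 := hyz v
      rw [hap, inner_add_left, inner_smul_left, inner_smul_left, Complex.conj_ofReal,
        Complex.conj_ofReal] at h1
      rw [← inner_conj_symm, ← inner_conj_symm y (A v)]
      congr 1
      rw [inner_smul_right, inner_sub_right, inner_smul_right]
      linear_combination (-(e : ℂ)) * h1 + (inner ℂ (A v) y : ℂ) * he'
    have ex : ∃ x : A.adjoint.domain, (x : H) = y ∧ A.adjoint x = (e : ℂ) • (z - (c : ℂ) • y) := by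
      have hm : y ∈ A.adjoint.domain := LinearPMap.mem_adjoint_domain_of_exists y ⟨_, key⟩
      exact ⟨⟨y, hm⟩, rfl, LinearPMap.adjoint_apply_eq hsa.1 ⟨y, hm⟩ key⟩
    rw [hsa.2] at ex
    obtain ⟨x, hx1, hx2⟩ := ex
    refine ⟨x, hx1, ?_⟩
    rw [hap, hx1, hx2, smul_smul, he', one_smul, sub_add_cancel]
  · intro x y
    exact hU (Submodule.inclusion h x) (Submodule.inclusion h y)
  · intro x hb hb'
    refine hc x hb ?_
    obtain ⟨C, hC⟩ := hb
    obtain ⟨C2, hC2⟩ := hb'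
    refine ⟨C2 + |c| * C, fun n => ?_⟩
    have e1 : A (x n) = (e : ℂ) • (shiftOp ((e : ℂ) • A.toFun) c (x n) - (c : ℂ) • (x n : H)) := by
      rw [hap, add_sub_cancel_right, smul_smul, he', one_smul]
    have e2 : |e| = 1 := by
      have := abs_mul_abs_self e
      nlinarith [abs_nonneg e]
    rw [e1, norm_smul, Complex.norm_real, Real.norm_eq_abs, e2, one_mul]
    refine (norm_sub_le _ _).trans ?_
    rw [norm_smul, Complex.norm_real, Real.norm_eq_abs]
    have := hC n
    have := hC2 n
    gcongr

lemma semi_form (A U : H →ₗ.[ℂ] H) (hA : IsSymmetricP A) (hU : IsSymmetricP U)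
    (hsa : IsSelfAdjointP A) (hsb : SemiboundedP A) (h : A.domain ≤ U.domain)
    (hc : ∀ x : ℕ → A.domain,
    (∃ C : ℝ, ∀ n, ‖((x n : H))‖ ≤ C) → (∃ C : ℝ, ∀ n, ‖A (x n)‖ ≤ C) →
    ∃ (φ : ℕ → ℕ) (y : H), StrictMono φ ∧
      Tendsto (fun n => U (Submodule.inclusion h (x (φ n)))) atTop (nhds y)) :
    (∃ C : ℝ, ∀ x : A.domain, ‖(x : H)‖ = 1 →
      ‖(inner ℂ (x : H) (U (Submodule.inclusion h x)) : ℂ)‖ ≤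
        (1 / 2) * |(inner ℂ (x : H) (A x) : ℂ).re| + C) ∧
    (∀ x : ℕ → A.domain, (∀ n, ‖(x n : H)‖ = 1) → WeakNull (fun n => (x n : H)) →
      (∃ C : ℝ, ∀ n, |(inner ℂ (x n : H) (A (x n)) : ℂ).re| ≤ C) →
      Tendsto (fun n => (inner ℂ (x n : H) (U (Submodule.inclusion h (x n))) : ℂ)) atTop (nhds 0)) := by
  obtain ⟨e, c, he, hpos⟩ : ∃ e c : ℝ, e * e = 1 ∧
      ∀ x : A.domain, 0 ≤ e * (inner ℂ (x : H) (A x) : ℂ).re + c * ‖(x : H)‖ ^ 2 := by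
    rcases hsb with ⟨γ, hγ⟩ | ⟨γ, hγ⟩
    · exact ⟨1, -γ, by norm_num, fun x => by have := hγ x; linarith⟩
    · exact ⟨-1, γ, by norm_num, fun x => by have := hγ x; linarith⟩
  have K := ksetup_of A U hA hU hsa h hc e c he
  have hre : ∀ x : A.domain, (inner ℂ (x : H) (shiftOp ((e : ℂ) • A.toFun) c x) : ℂ).re
      = e * (inner ℂ (x : H) (A x) : ℂ).re + c * ‖(x : H)‖ ^ 2 := by
    intro x
    rw [re_inner_shift]
    congr 1
    change (inner ℂ (x : H) ((e : ℂ) • A x) : ℂ).re = _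
    rw [inner_smul_right, Complex.re_ofReal_mul]
  have pos : ∀ x : A.domain, 0 ≤ (inner ℂ (x : H) (shiftOp ((e : ℂ) • A.toFun) c x) : ℂ).re :=
    fun x => by rw [hre]; exact hpos x
  have e2 : |e| = 1 := by
    have := abs_mul_abs_self e
    nlinarith [abs_nonneg e]
  have hle : ∀ r : ℝ, e * r ≤ |r| := fun r => by
    have := le_abs_self (e * r); rwa [abs_mul, e2, one_mul] at this
  constructor
  · obtain ⟨s, hs, hb⟩ := K.formbound pos (1 / 2) (by norm_num)
    refine ⟨(1 / 2) * (c + s), fun x hx => ?_⟩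
    have h1 := hb x
    rw [hre, hx] at h1
    have h2 := hle (inner ℂ (x : H) (A x) : ℂ).re
    refine le_trans h1 ?_
    linarith
  · rintro x hx hw ⟨C, hC⟩
    refine K.form_tendsto pos x hx hw (C + c) fun n => ?_
    rw [hre, hx]
    have h2 := hle (inner ℂ (x n : H) (A (x n)) : ℂ).re
    have := hC n
    linarith

lemma sym_im (A : H →ₗ.[ℂ] H) (hA : IsSymmetricP A) (x : A.domain) :
    (inner ℂ (x : H) (A x) : ℂ).im = 0 := by
  have h1 := hA x x
  rw [← inner_conj_symm] at h1
  exact Complex.conj_eq_iff_im.mp h1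

/-- One step: boundedness of the (perturbed) form implies boundedness of the form of `A`. -/
lemma bdd_of_pert (a u : ℕ → ℂ) (C : ℝ) (hu : ∀ n, ‖u n‖ ≤ (1 / 2) * |(a n).re| + C)
    (K : ℝ) (hK : ∀ n, |(a n).re + (u n).re| ≤ K) : ∃ C : ℝ, ∀ n, |(a n).re| ≤ C := by
  refine ⟨2 * (K + C), fun n => ?_⟩
  have h1 := hu n
  have h2 := hK n
  have h3 := Complex.abs_re_le_norm (u n)
  have h4 : |(a n).re| ≤ |(a n).re + (u n).re| + |(u n).re| := by
    have := abs_sub ((a n).re + (u n).re) ((u n).re)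
    rwa [add_sub_cancel_right] at this
  linarith

lemma bdd_re (f : ℕ → ℂ) (z : ℂ) (h : Tendsto f atTop (nhds z)) :
    ∃ C : ℝ, ∀ n, |(f n).re| ≤ C := by
  obtain ⟨C, hC⟩ := h.norm.bddAbove_range
  exact ⟨C, fun n => (Complex.abs_re_le_norm _).trans (hC ⟨n, rfl⟩)⟩

lemma bdd_im (f : ℕ → ℂ) (z : ℂ) (h : Tendsto f atTop (nhds z)) :
    ∃ C : ℝ, ∀ n, |(f n).im| ≤ C := by
  obtain ⟨C, hC⟩ := h.norm.bddAbove_range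
  exact ⟨C, fun n => (Complex.abs_im_le_norm _).trans (hC ⟨n, rfl⟩)⟩

/-- Reduction to forms. -/
lemma reduction (A B U V : H →ₗ.[ℂ] H)
    (hA : IsSymmetricP A) (hB : IsSymmetricP B)
    (hU : IsSymmetricP U) (hV : IsSymmetricP V)
    (hdU : A.domain ⊓ B.domain ≤ U.domain) (hdV : A.domain ⊓ B.domain ≤ V.domain)
    (main : ∀ x : ℕ → (A.domain ⊓ B.domain : Submodule ℂ H), (∀ n, ‖(x n : H)‖ = 1) →
      WeakNull (fun n => (x n : H)) →
      ((∃ C : ℝ, ∀ n, |(inner ℂ (x n : H) (A ⟨x n, (x n).2.1⟩) : ℂ).re| ≤ C) ∧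
        (∃ C : ℝ, ∀ n, |(inner ℂ (x n : H) (B ⟨x n, (x n).2.2⟩) : ℂ).re| ≤ C) ∨
       (∃ C : ℝ, ∀ n, |(inner ℂ (x n : H) (A ⟨x n, (x n).2.1⟩) : ℂ).re +
          (inner ℂ (x n : H) (U ⟨x n, hdU (x n).2⟩) : ℂ).re| ≤ C) ∧
        (∃ C : ℝ, ∀ n, |(inner ℂ (x n : H) (B ⟨x n, (x n).2.2⟩) : ℂ).re +
          (inner ℂ (x n : H) (V ⟨x n, hdV (x n).2⟩) : ℂ).re| ≤ C)) →
      Tendsto (fun n => (inner ℂ (x n : H) (U ⟨x n, hdU (x n).2⟩) : ℂ)) atTop (nhds 0) ∧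
      Tendsto (fun n => (inner ℂ (x n : H) (V ⟨x n, hdV (x n).2⟩) : ℂ)) atTop (nhds 0)) :
    essNumRange (combineI A B) =
      essNumRange (pmapAdd (combineI A B) (combineI U V)) := by
  have hT : ∀ (x : H) (h1 : x ∈ A.domain ⊓ B.domain),
      (inner ℂ x ((combineI A B) ⟨x, h1⟩) : ℂ) =
        inner ℂ x (A ⟨x, h1.1⟩) + Complex.I * inner ℂ x (B ⟨x, h1.2⟩) := by
    intro x h1
    change (inner ℂ x (A ⟨x, h1.1⟩ + Complex.I • B ⟨x, h1.2⟩) : ℂ) = _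
    rw [inner_add_right, inner_smul_right]
  have hTS : ∀ (x : H) (h1 : x ∈ A.domain ⊓ B.domain)
      (h2 : x ∈ (pmapAdd (combineI A B) (combineI U V)).domain),
      (inner ℂ x ((pmapAdd (combineI A B) (combineI U V)) ⟨x, h2⟩) : ℂ) =
        (inner ℂ x (A ⟨x, h1.1⟩) + Complex.I * inner ℂ x (B ⟨x, h1.2⟩)) +
        (inner ℂ x (U ⟨x, hdU h1⟩) + Complex.I * inner ℂ x (V ⟨x, hdV h1⟩)) := by
    intro x h1 h2
    change (inner ℂ x ((A ⟨x, h1.1⟩ + Complex.I • B ⟨x, h1.2⟩) +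
      (U ⟨x, hdU h1⟩ + Complex.I • V ⟨x, hdV h1⟩)) : ℂ) = _
    simp only [inner_add_right, inner_smul_right]
  have hz0 : ∀ (u v : ℕ → ℂ), Tendsto u atTop (nhds 0) → Tendsto v atTop (nhds 0) →
      Tendsto (fun n => u n + Complex.I * v n) atTop (nhds 0) := by
    intro u v hu hv
    simpa using hu.add (hv.const_mul Complex.I)
  apply Set.Subset.antisymm
  · rintro z ⟨x, hx1, hw, ht⟩
    have ht' : Tendsto (fun n => (inner ℂ (x n : H) (A ⟨x n, (x n).2.1⟩) : ℂ) +
        Complex.I * inner ℂ (x n : H) (B ⟨x n, (x n).2.2⟩)) atTop (nhds z) :=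
      ht.congr fun n => hT _ (x n).2
    have m := main x hx1 hw (Or.inl ⟨by
      obtain ⟨C, hC⟩ := bdd_re _ _ ht'
      refine ⟨C, fun n => ?_⟩
      have h1 := hC n
      have h2 := sym_im B hB ⟨x n, (x n).2.2⟩
      simp only [Complex.add_re, Complex.I_mul_re, h2, neg_zero, add_zero] at h1
      exact h1, by
      obtain ⟨C, hC⟩ := bdd_im _ _ ht'
      refine ⟨C, fun n => ?_⟩
      have h1 := hC n
      have h2 := sym_im A hA ⟨x n, (x n).2.1⟩
      simp only [Complex.add_im, Complex.I_mul_im, h2, zero_add] at h1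
      exact h1⟩)
    refine ⟨fun n => ⟨x n, (x n).2, hdU (x n).2, hdV (x n).2⟩, hx1, hw, ?_⟩
    have := ht'.add (hz0 _ _ m.1 m.2)
    rw [add_zero] at this
    exact this.congr fun n => (hTS _ (x n).2 _).symm
  · rintro z ⟨x, hx1, hw, ht⟩
    have ht' : Tendsto (fun n => ((inner ℂ (x n : H) (A ⟨x n, (x n).2.1.1⟩) : ℂ) +
        Complex.I * inner ℂ (x n : H) (B ⟨x n, (x n).2.1.2⟩)) +
        (inner ℂ (x n : H) (U ⟨x n, hdU (x n).2.1⟩) +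
        Complex.I * inner ℂ (x n : H) (V ⟨x n, hdV (x n).2.1⟩))) atTop (nhds z) :=
      ht.congr fun n => hTS _ (x n).2.1 _
    have m := main (fun n => ⟨x n, (x n).2.1⟩) hx1 hw (Or.inr ⟨by
      obtain ⟨C, hC⟩ := bdd_re _ _ ht'
      refine ⟨C, fun n => ?_⟩
      have h1 := hC n
      have h2 := sym_im B hB ⟨x n, (x n).2.1.2⟩
      have h3 := sym_im V hV ⟨x n, hdV (x n).2.1⟩
      simp only [Complex.add_re, Complex.I_mul_re, h2, h3, neg_zero, add_zero] at h1
      exact h1, by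
      obtain ⟨C, hC⟩ := bdd_im _ _ ht'
      refine ⟨C, fun n => ?_⟩
      have h1 := hC n
      have h2 := sym_im A hA ⟨x n, (x n).2.1.1⟩
      have h3 := sym_im U hU ⟨x n, hdU (x n).2.1⟩
      simp only [Complex.add_im, Complex.I_mul_im, h2, h3, zero_add] at h1
      exact h1⟩)
    refine ⟨fun n => ⟨x n, (x n).2.1⟩, hx1, hw, ?_⟩
    have := ht'.sub (hz0 _ _ m.1 m.2)
    rw [sub_zero] at this
    refine this.congr fun n => ?_
    rw [add_sub_cancel_right]
    exact (hT _ (x n).2.1).symm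

end Concrete

/-- Theorem 4.5: perturbation invariance of the essential numerical range for operators
`T = A + iB` under perturbations `S = U + iV` which decompose into symmetric relatively
compact real and imaginary parts. -/
theorem essNumRange_eq_of_decomposable_perturbation
    [TopologicalSpace.SeparableSpace H] (hinf : ¬FiniteDimensional ℂ H)
    (A B U V : H →ₗ.[ℂ] H)
    (hA : IsSymmetricP A) (hB : IsSymmetricP B)
    (hU : IsSymmetricP U) (hV : IsSymmetricP V)
    (hcase :
      (IsSelfAdjointP A ∧ SemiboundedP A ∧ RelCompactP U A ∧ RelCompactP V A) ∨
      (IsSelfAdjointP B ∧ SemiboundedP B ∧ RelCompactP U B ∧ RelCompactP V B) ∨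
      (IsSelfAdjointP A ∧ SemiboundedP A ∧ IsSelfAdjointP B ∧ SemiboundedP B ∧
        RelCompactP U A ∧ RelCompactP V B)) :
    essNumRange (combineI A B) =
      essNumRange (pmapAdd (combineI A B) (combineI U V)) := by
  rcases hcase with ⟨sa, sb, ⟨hdU, cU⟩, ⟨hdV, cV⟩⟩ | ⟨sa, sb, ⟨hdU, cU⟩, ⟨hdV, cV⟩⟩ |
    ⟨sa, sb, sa', sb', ⟨hdU, cU⟩, ⟨hdV, cV⟩⟩
  · refine reduction A B U V hA hB hU hV (inf_le_left.trans hdU) (inf_le_left.trans hdV) ?_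
    intro x hx hw hcs
    obtain ⟨⟨C, f1⟩, f2⟩ := semi_form A U hA hU sa sb hdU cU
    obtain ⟨_, g2⟩ := semi_form A V hA hV sa sb hdV cV
    have hb : ∃ C : ℝ, ∀ n, |(inner ℂ (x n : H) (A ⟨x n, (x n).2.1⟩) : ℂ).re| ≤ C := by
      rcases hcs with ⟨h, _⟩ | ⟨⟨K, hK⟩, _⟩
      · exact h
      · exact bdd_of_pert _ _ C (fun n => f1 ⟨x n, (x n).2.1⟩ (hx n)) K hK
    exact ⟨f2 (fun n => ⟨x n, (x n).2.1⟩) hx hw hb, g2 (fun n => ⟨x n, (x n).2.1⟩) hx hw hb⟩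
  · refine reduction A B U V hA hB hU hV (inf_le_right.trans hdU) (inf_le_right.trans hdV) ?_
    intro x hx hw hcs
    obtain ⟨_, f2⟩ := semi_form B U hB hU sa sb hdU cU
    obtain ⟨⟨C, g1⟩, g2⟩ := semi_form B V hB hV sa sb hdV cV
    have hb : ∃ C : ℝ, ∀ n, |(inner ℂ (x n : H) (B ⟨x n, (x n).2.2⟩) : ℂ).re| ≤ C := by
      rcases hcs with ⟨_, h⟩ | ⟨_, ⟨K, hK⟩⟩
      · exact h
      · exact bdd_of_pert _ _ C (fun n => g1 ⟨x n, (x n).2.2⟩ (hx n)) K hK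
    exact ⟨f2 (fun n => ⟨x n, (x n).2.2⟩) hx hw hb, g2 (fun n => ⟨x n, (x n).2.2⟩) hx hw hb⟩
  · refine reduction A B U V hA hB hU hV (inf_le_left.trans hdU) (inf_le_right.trans hdV) ?_
    intro x hx hw hcs
    obtain ⟨⟨C, f1⟩, f2⟩ := semi_form A U hA hU sa sb hdU cU
    obtain ⟨⟨C2, g1⟩, g2⟩ := semi_form B V hB hV sa' sb' hdV cV
    have hb : ∃ C : ℝ, ∀ n, |(inner ℂ (x n : H) (A ⟨x n, (x n).2.1⟩) : ℂ).re| ≤ C := by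
      rcases hcs with ⟨h, _⟩ | ⟨⟨K, hK⟩, _⟩
      · exact h
      · exact bdd_of_pert _ _ C (fun n => f1 ⟨x n, (x n).2.1⟩ (hx n)) K hK
    have hb' : ∃ C : ℝ, ∀ n, |(inner ℂ (x n : H) (B ⟨x n, (x n).2.2⟩) : ℂ).re| ≤ C := by
      rcases hcs with ⟨_, h⟩ | ⟨_, ⟨K, hK⟩⟩
      · exact h
      · exact bdd_of_pert _ _ C2 (fun n => g1 ⟨x n, (x n).2.2⟩ (hx n)) K hK
    exact ⟨f2 (fun n => ⟨x n, (x n).2.1⟩) hx hw hb, g2 (fun n => ⟨x n, (x n).2.2⟩) hx hw hb'⟩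
end
end

section
/- Let A be a selfadjoint operator in H which is uniformly positive (there exists c > 0 with ⟨Ax, x⟩ ≥ c‖x‖² for all x ∈ dom(A)) and surjective onto H, so that A⁻¹ is a bounded positive selfadjoint operator on H, and let R denote the bounded positive square root of A⁻¹ (R² = A⁻¹, R ≥ 0 bounded selfadjoint). Let B be a symmetric operator in H and set T := A + iB with dom(T) := dom(A) ∩ dom(B). Let S be a linear operator in H with ran(R) ⊆ dom(S) such that the everywhere-defined operator x ↦ R(S(Rx)) on H is compact. Then W_e(T) = W_e(T + S), where T + S has domain dom(T) (note that dom(A) ⊆ ran(R), since x = R(R(Ax)) for x ∈ dom(A)). -/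
open Filter Topology

noncomputable section

variable {H : Type*} [NormedAddCommGroup H] [InnerProductSpace ℂ H] [CompleteSpace H]

/-- If `R` is selfadjoint and injective, `(u_n)` is bounded and `(R u_n)` is weakly null, then
`⟨u_n, K u_n⟩ → 0` for every compact `K`. -/
theorem form_tendsto_zero (R K : H →L[ℂ] H) (hRsa : IsSelfAdjoint R)
    (hRinj : ∀ x, R x = 0 → x = 0) (hK : IsCompactOperator K)
    (u : ℕ → H) (C : ℝ) (hC : ∀ n, ‖u n‖ ≤ C) (hu : WeakNull (fun n => R (u n))) :
    Tendsto (fun n => (inner ℂ (u n) (K (u n)) : ℂ)) atTop (nhds 0) := by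
  have hC0 : 0 ≤ C := (norm_nonneg _).trans (hC 0)
  have hsym : ∀ x y, (inner ℂ (R x) y : ℂ) = inner ℂ x (R y) := fun x y => by
    conv_lhs => rw [← hRsa.adjoint_eq]
    exact ContinuousLinearMap.adjoint_inner_left R y x
  have hdense : Dense (Set.range R) := by
    have h : (LinearMap.range (R : H →ₗ[ℂ] H)).topologicalClosure = ⊤ := by
      rw [Submodule.topologicalClosure_eq_top_iff, Submodule.eq_bot_iff]
      intro x hx
      apply hRinj
      have := hx (R (R x)) ⟨R x, rfl⟩
      rw [hsym] at this
      exact inner_self_eq_zero.1 this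
    have h2 := Submodule.dense_iff_topologicalClosure_eq_top.2 h
    have h3 : ((LinearMap.range (R : H →ₗ[ℂ] H) : Submodule ℂ H) : Set H) = Set.range R := rfl
    rwa [h3] at h2
  have hw : WeakNull u := by
    intro w
    rw [Metric.tendsto_atTop]
    intro ε hε
    obtain ⟨g, ⟨v, rfl⟩, hg⟩ := Metric.mem_closure_iff.1 (hdense w) (ε / (2 * (C + 1)))
      (by positivity)
    obtain ⟨N, hN⟩ := (Metric.tendsto_atTop.1 (hu v)) (ε / 2) (by positivity)
    refine ⟨N, fun n hn => ?_⟩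
    have h1 := hN n hn
    simp only [dist_zero_right] at h1 ⊢
    rw [hsym] at h1
    have h2 : (inner ℂ (u n) w : ℂ) = inner ℂ (u n) (w - R v) + inner ℂ (u n) (R v) := by
      rw [← inner_add_right, sub_add_cancel]
    have h3 : ‖(inner ℂ (u n) (w - R v) : ℂ)‖ ≤ ε / 2 := by
      refine (norm_inner_le_norm _ _).trans ?_
      rw [dist_eq_norm] at hg
      calc ‖u n‖ * ‖w - R v‖ ≤ (C + 1) * (ε / (2 * (C + 1))) := by
            gcongr
            linarith [hC n]
        _ = ε / 2 := by field_simp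
    rw [h2]
    exact (norm_add_le _ _).trans_lt (by linarith)
  have hKu : Tendsto (fun n => K (u n)) atTop (nhds 0) := by
    obtain ⟨M, hM, hMs⟩ := IsCompactOperator.image_closedBall_subset_compact
      (f := (K : H →ₗ[ℂ] H)) hK C
    refine hM.tendsto_nhds_of_unique_mapClusterPt (Eventually.of_forall fun n =>
      hMs ⟨u n, by simpa using hC n, rfl⟩) ?_
    intro v _ hv
    have h1 : MapClusterPt (inner ℂ v v : ℂ) atTop
        ((fun z => (inner ℂ z v : ℂ)) ∘ fun n => K (u n)) :=
      hv.continuousAt_comp (f := fun z => (inner ℂ z v : ℂ)) (by fun_prop)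
    have h2 : Tendsto ((fun z => (inner ℂ z v : ℂ)) ∘ fun n => K (u n)) atTop (nhds 0) := by
      have := hw (K.adjoint v)
      simpa [Function.comp_def, ContinuousLinearMap.adjoint_inner_right] using this
    have h3 : (inner ℂ v v : ℂ) = 0 := by
      by_contra hne
      have hd := disjoint_nhds_nhds.2 hne
      exact (h1.clusterPt.mono h2).ne (disjoint_iff.1 hd)
    exact inner_self_eq_zero.1 h3
  refine squeeze_zero_norm (a := fun n => C * ‖K (u n)‖) (fun n => ?_) ?_
  · exact (norm_inner_le_norm _ _).trans (by gcongr; exact hC n)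
  · simpa using hKu.norm.const_mul C

/-- Theorem 4.6: let `T = A + iB` with `A` uniformly positive (and selfadjoint,
surjective, so that `A⁻¹` exists and is bounded, with positive square root `R`,
i.e. `R² = A⁻¹`) and `B` symmetric, and let `S` satisfy `ran R ⊆ dom S` with
`R S R` (i.e. `A^{-1/2} S A^{-1/2}`) compact. Then `W_e(T) = W_e(T + S)`,
where `T + S` has domain `dom T` (note `dom A ⊆ ran R ⊆ dom S`). -/
theorem essNumRange_eq_of_sqrt_compact_perturbation
    [TopologicalSpace.SeparableSpace H] (hinf : ¬FiniteDimensional ℂ H)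
    (A B S : H →ₗ.[ℂ] H) (R : H →L[ℂ] H)
    (hAdense : Dense (A.domain : Set H)) (hAsa : A.adjoint = A)
    (hApos : ∃ c : ℝ, 0 < c ∧
      ∀ x : A.domain, c * ‖(x : H)‖ ^ 2 ≤ (inner ℂ ((x : H)) (A x) : ℂ).re)
    (hAsurj : ∀ y : H, ∃ x : A.domain, A x = y)
    (hRsa : IsSelfAdjoint R)
    (hRpos : ∀ x : H, 0 ≤ (inner ℂ x (R x) : ℂ).re)
    (hRA : ∀ x : A.domain, R (R (A x)) = (x : H))
    (hAR : ∀ y : H, ∃ x : A.domain, (x : H) = R (R y) ∧ A x = y)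
    (hBsym : IsSymmetricP B)
    (hRS : ∀ x : H, R x ∈ S.domain)
    (hcpt : IsCompactOperator fun x : H => R (S ⟨R x, hRS x⟩)) :
    essNumRange (combineI A B) = essNumRange (pmapAdd (combineI A B) S) := by
  have hsym : ∀ x y, (inner ℂ (R x) y : ℂ) = inner ℂ x (R y) := fun x y => by
    conv_lhs => rw [← hRsa.adjoint_eq]
    exact ContinuousLinearMap.adjoint_inner_left R y x
  have hRinj : ∀ x, R x = 0 → x = 0 := by
    intro y hy
    obtain ⟨x, hx, hxy⟩ := hAR y
    have : x = 0 := by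
      apply Subtype.ext
      rw [hx, hy, map_zero]
      rfl
    rw [← hxy, this, LinearPMap.map_zero]
  -- the compact operator
  let K₀ : H →ₗ[ℂ] H := (R : H →ₗ[ℂ] H) ∘ₗ S.toFun ∘ₗ
    (LinearMap.codRestrict S.domain (R : H →ₗ[ℂ] H) hRS)
  have hK₀ : IsCompactOperator K₀ := hcpt
  let K : H →L[ℂ] H := ⟨K₀, hK₀.continuous⟩
  have hK : IsCompactOperator K := hK₀
  have hform : ∀ (y z : H) (hz : z ∈ S.domain), z = R y →
      (inner ℂ z (S ⟨z, hz⟩) : ℂ) = inner ℂ y (K y) := by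
    intro y z hz h
    subst h
    exact hsym _ _
  let T := combineI A B
  let Y : T.domain → H := fun x => R (A ⟨x, x.2.1⟩)
  have hRY : ∀ x : T.domain, (x : H) = R (Y x) := fun x => (hRA ⟨x, x.2.1⟩).symm
  have hTS : ∀ x : T.domain, (x : H) ∈ S.domain := fun x => by
    rw [hRY x]; exact hRS _
  have hre : ∀ x : T.domain, (inner ℂ (x : H) (T x) : ℂ).re = ‖Y x‖ ^ 2 := by
    intro x
    have h1 : T x = A ⟨x, x.2.1⟩ + Complex.I • B ⟨x, x.2.2⟩ := rfl
    have h2 : (inner ℂ (x : H) (A ⟨x, x.2.1⟩) : ℂ) = inner ℂ (Y x) (Y x) := by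
      exact (congrArg (fun v => (inner ℂ v (A ⟨x, x.2.1⟩) : ℂ)) (hRY x)).trans (hsym _ _)
    have h3 : (inner ℂ (x : H) (B ⟨x, x.2.2⟩) : ℂ).im = 0 := by
      have h4 := hBsym ⟨x, x.2.2⟩ ⟨x, x.2.2⟩
      have h5 := inner_conj_symm (𝕜 := ℂ) (x : H) (B ⟨x, x.2.2⟩)
      exact Complex.conj_eq_iff_im.1 (by rw [← h4, inner_conj_symm]; exact h4.symm)
    rw [h1, inner_add_right, inner_smul_right, h2, Complex.add_re, Complex.mul_re, h3]
    simp only [Complex.I_re, Complex.I_im, zero_mul, mul_zero, sub_zero, add_zero]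
    exact (norm_sq_eq_re_inner (𝕜 := ℂ) (Y x)).symm
  have hsum : ∀ (x : T.domain) (x' : (pmapAdd T S).domain), (x' : H) = x →
      (inner ℂ (x' : H) (pmapAdd T S x') : ℂ)
        = inner ℂ (x : H) (T x) + inner ℂ (Y x) (K (Y x)) := by
    rintro x ⟨x', hx'⟩ h
    dsimp only at h
    subst h
    have h1 : pmapAdd T S ⟨x, hx'⟩ = T x + S ⟨x, hTS x⟩ := rfl
    rw [h1, inner_add_right, hform (Y x) x (hTS x) (hRY x)]
  ext z
  constructor
  · rintro ⟨x, hx1, hxw, hxz⟩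
    refine ⟨fun n => ⟨x n, (x n).2, hTS (x n)⟩, hx1, hxw, ?_⟩
    obtain ⟨D, hD⟩ := hxz.norm.bddAbove_range
    have hD' : ∀ n, ‖Y (x n)‖ ^ 2 ≤ D := fun n => by
      rw [← hre]
      exact (Complex.re_le_norm _).trans (hD ⟨n, rfl⟩)
    have hlim := form_tendsto_zero R K hRsa hRinj hK (fun n => Y (x n)) (Real.sqrt D)
      (fun n => Real.le_sqrt_of_sq_le (hD' n)) (by
        simp only [← hRY]
        exact hxw)
    have := hxz.add hlim
    rw [add_zero] at this
    exact this.congr fun n => (hsum (x n) ⟨x n, (x n).2, hTS (x n)⟩ rfl).symm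
  · rintro ⟨x', hx1, hxw, hxz⟩
    let x : ℕ → T.domain := fun n => ⟨x' n, (x' n).2.1⟩
    have hval : ∀ n, (inner ℂ (x' n : H) (pmapAdd T S (x' n)) : ℂ)
        = inner ℂ (x n : H) (T (x n)) + inner ℂ (Y (x n)) (K (Y (x n))) :=
      fun n => hsum (x n) (x' n) rfl
    have hbdd : ∃ C, ∀ n, ‖Y (x n)‖ ≤ C := by
      by_contra hcon
      push Not at hcon
      choose φ hφ using fun k : ℕ => hcon (k + 1)
      obtain ⟨D, hD⟩ := hxz.norm.bddAbove_range
      have hpos : ∀ k, 0 < ‖Y (x (φ k))‖ := fun k => lt_trans (by positivity) (hφ k)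
      let r : ℕ → ℝ := fun k => ‖Y (x (φ k))‖⁻¹
      have hr0 : Tendsto r atTop (nhds 0) := by
        refine squeeze_zero (fun k => by positivity) (fun k => ?_)
          tendsto_one_div_add_atTop_nhds_zero_nat
        rw [one_div]
        exact inv_anti₀ (by positivity) (hφ k).le
      let u : ℕ → H := fun k => (r k : ℂ) • Y (x (φ k))
      have hun : ∀ k, ‖u k‖ = 1 := fun k => by
        simp only [u, r, norm_smul, Complex.norm_real, norm_inv, norm_norm]
        exact inv_mul_cancel₀ (hpos k).ne'
      have hRu : Tendsto (fun k => R (u k)) atTop (nhds 0) := by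
        rw [tendsto_zero_iff_norm_tendsto_zero]
        refine hr0.congr fun k => ?_
        simp only [u, map_smul, ← hRY, norm_smul, Complex.norm_real]
        have : ‖(x (φ k) : H)‖ = 1 := hx1 _
        rw [this, mul_one, Real.norm_of_nonneg (by positivity)]
      have hlim := form_tendsto_zero R K hRsa hRinj hK u 1 (fun k => (hun k).le) (by
        intro w
        simpa using hRu.inner (tendsto_const_nhds (x := w)) (𝕜 := ℂ))
      have hlim2 : Tendsto (fun k => 1 + (inner ℂ (u k) (K (u k)) : ℂ).re) atTop (nhds 1) := by
        simpa using ((Complex.continuous_re.tendsto 0).comp hlim).const_add 1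
      have hle : ∀ k, 1 + (inner ℂ (u k) (K (u k)) : ℂ).re ≤ r k ^ 2 * D := by
        intro k
        have h1 : (inner ℂ (u k) (K (u k)) : ℂ)
            = ((r k ^ 2 : ℝ) : ℂ) * inner ℂ (Y (x (φ k))) (K (Y (x (φ k)))) := by
          simp only [u, map_smul, inner_smul_left, inner_smul_right, Complex.conj_ofReal]
          push_cast
          ring
        have h2 : r k ^ 2 * ‖Y (x (φ k))‖ ^ 2 = 1 := by
          rw [← mul_pow, inv_mul_cancel₀ (hpos k).ne', one_pow]
        rw [h1, Complex.re_ofReal_mul, ← h2, ← mul_add, ← hre, ← Complex.add_re, ← hval]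
        gcongr
        exact (Complex.re_le_norm _).trans (hD ⟨φ k, rfl⟩)
      have hlim3 : Tendsto (fun k => r k ^ 2 * D) atTop (nhds 0) := by
        simpa using (hr0.pow 2).mul_const D
      have := le_of_tendsto_of_tendsto' hlim2 hlim3 hle
      linarith
    obtain ⟨C, hC⟩ := hbdd
    refine ⟨x, hx1, hxw, ?_⟩
    have hlim := form_tendsto_zero R K hRsa hRinj hK (fun n => Y (x n)) C hC (by
        simp only [← hRY]
        exact hxw)
    have := hxz.sub hlim
    rw [sub_zero] at this
    refine this.congr fun n => ?_
    rw [hval, add_sub_cancel_right]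
end
end

section
/- Let T be a densely defined linear operator in H, let H_n ⊆ dom(T) be finite-dimensional subspaces with P_{H_n} →s I, and let T_{H_n} := P_{H_n} T|_{H_n} be the compressions. Assume T_{H_n} →gsr T. Then: (i) W_e((T_{H_n})) = W_e(T); (ii) spectral pollution is confined to W_e(T): if λ ∈ ℂ \ σ(T) and there exist an infinite set I ⊆ ℕ and eigenvalues λ_n ∈ σ(T_{H_n}) for n ∈ I with λ_n → λ, then λ ∈ W_e(T); (iii) every isolated point λ of σ(T) with λ ∉ W_e(T) is approximated: there exist an infinite set I ⊆ ℕ and λ_n ∈ σ(T_{H_n}) for n ∈ I with λ_n → λ. -/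
open Filter Topology

noncomputable section

variable {H : Type*} [NormedAddCommGroup H] [InnerProductSpace ℂ H] [CompleteSpace H]

/-- `Rr` is the (bounded, everywhere defined) inverse of `T - lam`, i.e. `lam` belongs to
the resolvent set of `T` with resolvent `Rr`. -/
def IsResolventOf {E : Type*} [NormedAddCommGroup E] [NormedSpace ℂ E]
    (T : E →ₗ.[ℂ] E) (lam : ℂ) (Rr : E →L[ℂ] E) : Prop :=
  (∀ x : T.domain, Rr (T x - lam • (x : E)) = (x : E)) ∧
  (∀ y : E, ∃ x : T.domain, (x : E) = Rr y ∧ T x - lam • (x : E) = y)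

/-- The resolvent set `ρ(T)`. -/
def resolventSetP (T : H →ₗ.[ℂ] H) : Set ℂ :=
  {lam | ∃ Rr : H →L[ℂ] H, IsResolventOf T lam Rr}

/-- The orthogonal projection onto a finite-dimensional subspace. -/
def projFD (M : Submodule ℂ H) (hfd : FiniteDimensional ℂ ↥M) : H →L[ℂ] ↥M :=
  letI := hfd
  letI : CompleteSpace ↥M := FiniteDimensional.complete ℂ ↥M
  Submodule.orthogonalProjectionOnto M

/-- The compression `T_M = P_M T|_M` of `T` to a finite-dimensional subspace
`M ⊆ dom T`, as an endomorphism of `M`. -/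
def compressFD (T : H →ₗ.[ℂ] H) (M : Submodule ℂ H) (hfd : FiniteDimensional ℂ ↥M)
    (h : M ≤ T.domain) : ↥M →ₗ[ℂ] ↥M :=
  (projFD M hfd).toLinearMap ∘ₗ (T.toFun.comp (Submodule.inclusion h))

/-- The limiting essential numerical range of the compressions `T_{H_n}` (endomorphisms
of the finite-dimensional subspaces `H_n`); convergence "along an infinite subset of ℕ"
is expressed via a strictly monotone subsequence. -/
def limEssNumRangeC (Hn : ℕ → Submodule ℂ H)
    (Tn : ∀ n, ↥(Hn n) →ₗ[ℂ] ↥(Hn n)) : Set ℂ :=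
  {z | ∃ φ : ℕ → ℕ, StrictMono φ ∧ ∃ x : ∀ k, ↥(Hn (φ k)),
    (∀ k, ‖((x k : H))‖ = 1) ∧
    (∀ y : H, Tendsto (fun k => (inner ℂ ((x k : H)) y : ℂ)) atTop (nhds 0)) ∧
    Tendsto (fun k => (inner ℂ ((x k : H)) ((Tn (φ k) (x k) : H)) : ℂ)) atTop (nhds z)}

/-- Generalized strong resolvent convergence `T_{H_n} →gsr T` for the compressions of `T`
to finite-dimensional subspaces `H_n ⊆ dom T`. -/
def GSRcompress (T : H →ₗ.[ℂ] H) (Hn : ℕ → Submodule ℂ H)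
    (hfd : ∀ n, FiniteDimensional ℂ ↥(Hn n)) (hle : ∀ n, Hn n ≤ T.domain) : Prop :=
  ∃ (n₀ : ℕ) (lam : ℂ) (Rr : H →L[ℂ] H) (Rn : ∀ n, ↥(Hn n) →ₗ[ℂ] ↥(Hn n)),
    IsResolventOf T lam Rr ∧
    (∀ n, n₀ ≤ n → ∀ x : ↥(Hn n),
      Rn n (compressFD T (Hn n) (hfd n) (hle n) x - lam • x) = x ∧
      compressFD T (Hn n) (hfd n) (hle n) (Rn n x) - lam • Rn n x = x) ∧
    ∀ x : H, Tendsto (fun n => ((Rn n (projFD (Hn n) (hfd n) x) : ↥(Hn n)) : H))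
      atTop (nhds (Rr x))

theorem inner_projFD (M : Submodule ℂ H) (hfd : FiniteDimensional ℂ ↥M) (v : M) (w : H) :
    inner ℂ (v : H) ((projFD M hfd w : M) : H) = inner ℂ (v : H) w := by
  let _ := hfd
  let _ : CompleteSpace ↥M := FiniteDimensional.complete ℂ ↥M
  exact (Submodule.inner_orthogonalProjectionOnto_eq_of_mem_left v w)

theorem inner_compressFD (T : H →ₗ.[ℂ] H) (M : Submodule ℂ H) (hfd : FiniteDimensional ℂ ↥M)
    (h : M ≤ T.domain) (v w : M) :
    inner ℂ (v : H) ((compressFD T M hfd h w : M) : H)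
      = inner ℂ (v : H) (T ⟨w, h w.2⟩) :=
  inner_projFD M hfd v _

/-- The approximation property given by generalized strong resolvent convergence. -/
def Approx (T : H →ₗ.[ℂ] H) (Hn : ℕ → Submodule ℂ H)
    (hfd : ∀ n, FiniteDimensional ℂ ↥(Hn n)) (hle : ∀ n, Hn n ≤ T.domain) : Prop :=
  ∀ x : T.domain, ∃ y : ∀ n, ↥(Hn n), Tendsto (fun n => (y n : H)) atTop (𝓝 (x : H)) ∧
    Tendsto (fun n => ((compressFD T (Hn n) (hfd n) (hle n) (y n) : Hn n) : H)) atTop (𝓝 (T x))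

theorem approx_of_gsr (T : H →ₗ.[ℂ] H)
    (Hn : ℕ → Submodule ℂ H) (hfd : ∀ n, FiniteDimensional ℂ ↥(Hn n))
    (hle : ∀ n, Hn n ≤ T.domain)
    (hP : ∀ x : H, Tendsto (fun n => ((projFD (Hn n) (hfd n) x : ↥(Hn n)) : H))
      atTop (nhds x))
    (hgsr : GSRcompress T Hn hfd hle) : Approx T Hn hfd hle := by
  obtain ⟨n₀, lam, Rr, Rn, hR, hRn, hconv⟩ := hgsr
  intro x
  have h1 := hconv (T x - lam • (x : H))
  rw [hR.1 x] at h1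
  refine ⟨_, h1, ?_⟩
  have h2 := (hP (T x - lam • (x : H))).add (h1.const_smul lam)
  rw [sub_add_cancel] at h2
  refine h2.congr' ?_
  filter_upwards [eventually_ge_atTop n₀] with n hn
  have h3 := (hRn n hn (projFD (Hn n) (hfd n) (T x - lam • (x : H)))).2
  rw [sub_eq_iff_eq_add] at h3
  rw [h3]; rfl

theorem mem_essNumRange_iff [TopologicalSpace.SeparableSpace H] (T : H →ₗ.[ℂ] H) (z : ℂ) :
    z ∈ essNumRange T ↔ ∀ (F : Finset H) (ε : ℝ), 0 < ε → ∃ x : T.domain, ‖(x : H)‖ = 1 ∧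
      (∀ y ∈ F, ‖(inner ℂ (x : H) y : ℂ)‖ < ε) ∧ ‖inner ℂ (x : H) (T x) - z‖ < ε := by
  constructor
  · rintro ⟨x, hx1, hx2, hx3⟩ F ε hε
    have h1 : ∀ᶠ n in atTop, ∀ y ∈ F, ‖(inner ℂ (x n : H) y : ℂ)‖ < ε := by
      rw [Filter.eventually_all_finset]
      intro y _
      have := (hx2 y).norm
      rw [norm_zero] at this
      exact this.eventually_lt_const hε
    have h2 : ∀ᶠ n in atTop, ‖inner ℂ (x n : H) (T (x n)) - z‖ < ε := by
      have := (tendsto_iff_norm_sub_tendsto_zero.1 hx3)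
      exact this.eventually_lt_const hε
    obtain ⟨n, hn1, hn2⟩ := (h1.and h2).exists
    exact ⟨x n, hx1 n, hn1, hn2⟩
  · intro h
    classical
    let d := TopologicalSpace.denseSeq H
    have hk : ∀ k : ℕ, ∃ x : T.domain, ‖(x : H)‖ = 1 ∧
      (∀ y ∈ (Finset.range k).image d, ‖(inner ℂ (x : H) y : ℂ)‖ < 1 / ((k : ℝ) + 1)) ∧
        ‖inner ℂ (x : H) (T x) - z‖ < 1 / ((k : ℝ) + 1) :=
      fun k => h _ _ Nat.one_div_pos_of_nat
    choose x hx1 hx2 hx3 using hk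
    refine ⟨x, hx1, ?_, ?_⟩
    · intro y
      rw [Metric.tendsto_atTop]
      intro ε hε
      obtain ⟨j, hj⟩ := (TopologicalSpace.denseRange_denseSeq H).exists_dist_lt y (half_pos hε)
      obtain ⟨N, hN⟩ := exists_nat_one_div_lt (half_pos hε)
      refine ⟨max N (j + 1), fun n hn => ?_⟩
      have hn1 : N ≤ n := le_trans (le_max_left _ _) hn
      have hn2 : j + 1 ≤ n := le_trans (le_max_right _ _) hn
      have e1 := hx2 n (d j) (Finset.mem_image_of_mem _ (Finset.mem_range.2 hn2))
      have e2 : 1 / ((n : ℝ) + 1) ≤ 1 / ((N : ℝ) + 1) := Nat.one_div_le_one_div hn1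
      have e3 : ‖(inner ℂ (x n : H) (y - d j) : ℂ)‖ ≤ ‖y - d j‖ := by
        have := norm_inner_le_norm (𝕜 := ℂ) (x n : H) (y - d j)
        rwa [hx1, one_mul] at this
      rw [dist_eq_norm] at hj
      have e4 : (inner ℂ (x n : H) y : ℂ) = inner ℂ (x n : H) (d j) + inner ℂ (x n : H) (y - d j) := by
        rw [← inner_add_right]; simp
      rw [dist_zero_right, e4]
      have := norm_add_le (inner ℂ (x n : H) (d j) : ℂ) (inner ℂ (x n : H) (y - d j))
      change ‖y - d j‖ < _ at hj
      linarith
    · rw [tendsto_iff_norm_sub_tendsto_zero]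
      exact squeeze_zero (fun _ => norm_nonneg _) (fun k => (hx3 k).le)
        tendsto_one_div_add_atTop_nhds_zero_nat

theorem essNumRange_compl_nhds [TopologicalSpace.SeparableSpace H] (T : H →ₗ.[ℂ] H) (z : ℂ)
    (hz : z ∉ essNumRange T) : ∃ ε > 0, ∀ w, dist w z < ε → w ∉ essNumRange T := by
  rw [mem_essNumRange_iff] at hz
  push Not at hz
  obtain ⟨F, ε, hε, h⟩ := hz
  refine ⟨ε / 2, half_pos hε, fun w hw hmem => ?_⟩
  rw [mem_essNumRange_iff] at hmem
  obtain ⟨x, hx1, hx2, hx3⟩ := hmem F (ε / 2) (half_pos hε)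
  have := h x hx1 (fun y hy => by linarith [hx2 y hy])
  rw [dist_eq_norm] at hw
  have h4 := norm_add_le (inner ℂ (x : H) (T x) - w) (w - z)
  rw [sub_add_sub_cancel] at h4
  linarith

theorem limEss_eq (T : H →ₗ.[ℂ] H)
    (Hn : ℕ → Submodule ℂ H) (hfd : ∀ n, FiniteDimensional ℂ ↥(Hn n))
    (hle : ∀ n, Hn n ≤ T.domain) (hA : Approx T Hn hfd hle) :
    limEssNumRangeC Hn (fun n => compressFD T (Hn n) (hfd n) (hle n)) = essNumRange T := by
  ext z
  constructor
  · rintro ⟨φ, hφ, x, hx1, hx2, hx3⟩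
    refine ⟨fun k => ⟨x k, hle _ (x k).2⟩, hx1, hx2, ?_⟩
    simpa only [inner_compressFD] using hx3
  · rintro ⟨x, hx1, hx2, hx3⟩
    have key : ∀ k : ℕ, ∀ᶠ n in atTop, ∃ v : Hn n, ‖(v : H)‖ = 1 ∧
        ‖(v : H) - x k‖ < 1 / ((k : ℝ) + 1) ∧
        ‖inner ℂ (v : H) ((compressFD T (Hn n) (hfd n) (hle n) v : Hn n) : H)
          - inner ℂ (x k : H) (T (x k))‖ < 1 / ((k : ℝ) + 1) := by
      intro k
      obtain ⟨y, hy1, hy2⟩ := hA (x k)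
      have hn : Tendsto (fun n => ‖(y n : H)‖) atTop (𝓝 1) := by
        have := hy1.norm; rwa [hx1] at this
      have hni : Tendsto (fun n => ((‖(y n : H)‖⁻¹ : ℝ) : ℂ)) atTop (𝓝 1) := by
        have := hn.inv₀ one_ne_zero
        rw [inv_one] at this
        exact (Complex.continuous_ofReal.tendsto' _ _ (by simp)).comp this
      have h1 := hni.smul hy1
      have h2 := hni.smul hy2
      rw [one_smul] at h1 h2
      have h3 := h1.inner (𝕜 := ℂ) h2
      have h1' := (tendsto_iff_norm_sub_tendsto_zero.1 h1).eventually_lt_const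
        (Nat.one_div_pos_of_nat (α := ℝ) (n := k))
      have h3' := (tendsto_iff_norm_sub_tendsto_zero.1 h3).eventually_lt_const
        (Nat.one_div_pos_of_nat (α := ℝ) (n := k))
      filter_upwards [h1', h3', hn.eventually_ne one_ne_zero] with n a1 a3 a0
      refine ⟨((‖(y n : H)‖⁻¹ : ℝ) : ℂ) • y n, ?_, ?_, ?_⟩
      · simp only [Submodule.coe_smul, norm_smul, Complex.norm_real, norm_inv, norm_norm]
        exact inv_mul_cancel₀ a0
      · exact a1
      · rw [map_smul]; exact a3
    obtain ⟨φ, hφ, h⟩ := Filter.extraction_forall_of_eventually key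
    choose v hv1 hv2 hv3 using h
    refine ⟨φ, hφ, v, hv1, fun y => ?_, ?_⟩
    · have h0 : Tendsto (fun k => (inner ℂ ((v k : H) - x k) y : ℂ)) atTop (𝓝 0) := by
        have hb := (tendsto_one_div_add_atTop_nhds_zero_nat (𝕜 := ℝ)).mul_const ‖y‖
        rw [zero_mul] at hb
        refine squeeze_zero_norm (fun k => ?_) hb
        exact (norm_inner_le_norm _ _).trans (by gcongr; exact (hv2 k).le)
      have := h0.add (hx2 y)
      rw [add_zero] at this
      refine this.congr fun k => ?_
      rw [← inner_add_left, sub_add_cancel]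
    · have h0 : Tendsto (fun k => inner ℂ (v k : H)
          ((compressFD T (Hn (φ k)) (hfd _) (hle _) (v k) : Hn (φ k)) : H)
          - inner ℂ (x k : H) (T (x k))) atTop (𝓝 0) :=
        squeeze_zero_norm (fun k => (hv3 k).le) tendsto_one_div_add_atTop_nhds_zero_nat
      have := h0.add hx3
      rw [zero_add] at this
      refine this.congr fun k => ?_
      rw [sub_add_cancel]

/-- Approximate left eigenvectors of the compressions yield points of the essential
numerical range. -/
theorem mem_ess_of_left (T : H →ₗ.[ℂ] H)
    (Hn : ℕ → Submodule ℂ H) (hfd : ∀ n, FiniteDimensional ℂ ↥(Hn n))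
    (hle : ∀ n, Hn n ≤ T.domain) (hA : Approx T Hn hfd hle)
    (lam : ℂ) (hlam : lam ∈ resolventSetP T)
    (φ : ℕ → ℕ) (hφ : Tendsto φ atTop atTop) (μ : ℕ → ℂ) (hμ : Tendsto μ atTop (𝓝 lam))
    (δ : ℕ → ℝ) (hδ : Tendsto δ atTop (𝓝 0))
    (v : ∀ k, Hn (φ k)) (hv : ∀ k, ‖(v k : H)‖ = 1)
    (hvy : ∀ k, ∀ y : Hn (φ k), ‖(inner ℂ (v k : H)
      ((compressFD T (Hn (φ k)) (hfd _) (hle _) y - μ k • y : Hn (φ k)) : H) : ℂ)‖ ≤ δ k * ‖(y : H)‖) :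
    lam ∈ essNumRange T := by
  refine ⟨fun k => ⟨v k, hle _ (v k).2⟩, hv, ?_, ?_⟩
  · intro w
    obtain ⟨R, hR⟩ := hlam
    obtain ⟨x, -, hx⟩ := hR.2 w
    obtain ⟨y, hy1, hy2⟩ := hA x
    have hy1 := hy1.comp hφ
    have hy2 := hy2.comp hφ
    have a1 := hy2.sub (hμ.smul hy1)
    rw [hx] at a1
    have a2 : Tendsto (fun k => (inner ℂ (v k : H) ((compressFD T (Hn (φ k)) (hfd _) (hle _)
        (y (φ k)) - μ k • y (φ k) : Hn (φ k)) : H) : ℂ)) atTop (𝓝 0) := by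
      have hb := hδ.mul hy1.norm
      rw [zero_mul] at hb
      exact squeeze_zero_norm (fun k => hvy k _) hb
    have a3 : Tendsto (fun k => (inner ℂ (v k : H) (w - ((compressFD T (Hn (φ k)) (hfd _) (hle _)
        (y (φ k)) - μ k • y (φ k) : Hn (φ k)) : H)) : ℂ)) atTop (𝓝 0) := by
      have hb := (tendsto_const_nhds (x := w)).sub a1
      rw [sub_self] at hb
      have hb := hb.norm
      rw [norm_zero] at hb
      refine squeeze_zero_norm (fun k => ?_) hb
      refine (norm_inner_le_norm _ _).trans ?_
      rw [hv, one_mul]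
      rfl
    have a4 := a2.add a3
    rw [add_zero] at a4
    refine a4.congr fun k => ?_
    rw [← inner_add_right, add_sub_cancel]
  · have a2 : Tendsto (fun k => (inner ℂ (v k : H) ((compressFD T (Hn (φ k)) (hfd _) (hle _)
        (v k) - μ k • v k : Hn (φ k)) : H) : ℂ)) atTop (𝓝 0) := by
      refine squeeze_zero_norm (fun k => ?_) hδ
      simpa [hv] using hvy k (v k)
    have a4 := a2.add hμ
    rw [zero_add] at a4
    refine a4.congr fun k => ?_
    rw [Submodule.coe_sub, inner_sub_right, inner_compressFD, Submodule.coe_smul, inner_smul_right,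
      inner_self_eq_norm_sq_to_K, hv]
    simp

theorem pollution (T : H →ₗ.[ℂ] H)
    (Hn : ℕ → Submodule ℂ H) (hfd : ∀ n, FiniteDimensional ℂ ↥(Hn n))
    (hle : ∀ n, Hn n ≤ T.domain) (hA : Approx T Hn hfd hle)
    (lam : ℂ) (hlam : lam ∈ resolventSetP T)
    (φ : ℕ → ℕ) (hφ : Tendsto φ atTop atTop) (μ : ℕ → ℂ) (hμ : Tendsto μ atTop (𝓝 lam))
    (hev : ∀ k, Module.End.HasEigenvalue
          (compressFD T (Hn (φ k)) (hfd (φ k)) (hle (φ k))) (μ k)) :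
    lam ∈ essNumRange T := by
  have key : ∀ k, ∃ v : Hn (φ k), ‖(v : H)‖ = 1 ∧ ∀ y : Hn (φ k), (inner ℂ (v : H)
      ((compressFD T (Hn (φ k)) (hfd _) (hle _) y - μ k • y : Hn (φ k)) : H) : ℂ) = 0 := by
    intro k
    have _ := hfd (φ k)
    set S := compressFD T (Hn (φ k)) (hfd _) (hle _) - algebraMap ℂ (Module.End ℂ (Hn (φ k))) (μ k)
      with hS
    have h1 : LinearMap.ker S ≠ ⊥ := by
      have := hev k
      rw [Module.End.hasEigenvalue_iff, Module.End.eigenspace_def] at this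
      exact this
    have h2 : LinearMap.range S ≠ ⊤ := by
      intro h
      exact h1 (LinearMap.ker_eq_bot_iff_range_eq_top.2 h)
    have h3 : (LinearMap.range S)ᗮ ≠ ⊥ := by
      rwa [Ne, Submodule.orthogonal_eq_bot_iff]
    obtain ⟨u, hu, hu0⟩ := Submodule.exists_mem_ne_zero_of_ne_bot h3
    refine ⟨((‖u‖⁻¹ : ℝ) : ℂ) • u, ?_, fun y => ?_⟩
    · simp only [Submodule.norm_coe, norm_smul, Complex.norm_real, norm_inv, norm_norm]
      exact inv_mul_cancel₀ (norm_ne_zero_iff.2 hu0)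
    · rw [Submodule.coe_smul, inner_smul_left]
      have := Submodule.inner_left_of_mem_orthogonal (LinearMap.mem_range_self S y) hu
      simp only [hS, LinearMap.sub_apply, Module.algebraMap_end_apply, Submodule.coe_inner] at this
      rw [this, mul_zero]
  choose v hv1 hv2 using key
  refine mem_ess_of_left T Hn hfd hle hA lam hlam φ hφ μ hμ (fun _ => 0) tendsto_const_nhds v hv1 ?_
  intro k y
  rw [hv2]; simp

theorem local_bound (T : H →ₗ.[ℂ] H)
    (Hn : ℕ → Submodule ℂ H) (hfd : ∀ n, FiniteDimensional ℂ ↥(Hn n))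
    (hle : ∀ n, Hn n ≤ T.domain) (hA : Approx T Hn hfd hle)
    (z : ℂ) (hz : z ∈ resolventSetP T) (hz' : z ∉ essNumRange T) :
    ∃ N : ℕ, ∃ δ > 0, ∀ n ≥ N, ∀ w, dist w z < δ → ∀ v : Hn n, ‖(v : H)‖ = 1 → ∃ y : Hn n,
      δ * ‖(y : H)‖ < ‖(inner ℂ (v : H)
      ((compressFD T (Hn n) (hfd _) (hle _) y - w • y : Hn n) : H) : ℂ)‖ := by
  by_contra hcon
  push Not at hcon
  have h : ∀ k : ℕ, _ := fun k : ℕ => hcon k (1 / ((k : ℝ) + 1)) Nat.one_div_pos_of_nat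
  choose φ hφ μ hμ v hv hvy using h
  refine hz' (mem_ess_of_left T Hn hfd hle hA z hz φ (tendsto_atTop_mono hφ tendsto_id) μ ?_
    _ tendsto_one_div_add_atTop_nhds_zero_nat v hv hvy)
  rw [tendsto_iff_dist_tendsto_zero]
  exact squeeze_zero (fun _ => dist_nonneg) (fun k => (hμ k).le)
    tendsto_one_div_add_atTop_nhds_zero_nat

theorem inverse_bound {E : Type*} [NormedAddCommGroup E] [InnerProductSpace ℂ E] [CompleteSpace E]
    (A : E →L[ℂ] E) (hA : IsUnit A) (δ : ℝ) (hδ : 0 < δ)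
    (h : ∀ v : E, ‖v‖ = 1 → ∃ y : E, δ * ‖y‖ < ‖(inner ℂ v (A y) : ℂ)‖) :
    ‖Ring.inverse A‖ ≤ δ⁻¹ := by
  have hAB : A * Ring.inverse A = 1 := Ring.mul_inverse_cancel A hA
  have hBA : Ring.inverse A * A = 1 := Ring.inverse_mul_cancel A hA
  set B := Ring.inverse A
  refine ContinuousLinearMap.opNorm_le_bound _ (inv_nonneg.2 hδ.le) fun u => ?_
  have hBAy : ∀ y, B (A y) = y := fun y => by
    have := congrArg (fun f : E →L[ℂ] E => f y) hBA
    simpa using this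
  set x := B u with hx
  set v := ContinuousLinearMap.adjoint B x with hv
  have h1 : δ * ‖v‖ ≤ ‖x‖ := by
    by_cases hv0 : v = 0
    · rw [hv0]; simp
    have hvn : 0 < ‖v‖ := norm_pos_iff.2 hv0
    obtain ⟨y, hy⟩ := h (((‖v‖⁻¹ : ℝ) : ℂ) • v) (by
      simp only [norm_smul, Complex.norm_real, norm_inv, norm_norm]
      exact inv_mul_cancel₀ hvn.ne')
    rw [inner_smul_left, norm_mul, hv, ContinuousLinearMap.adjoint_inner_left, hBAy, ← hv] at hy
    simp only [RCLike.norm_conj, Complex.norm_real, norm_inv, norm_norm] at hy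
    have h2 := norm_inner_le_norm (𝕜 := ℂ) x y
    have h3 : δ * ‖y‖ < ‖v‖⁻¹ * (‖x‖ * ‖y‖) := hy.trans_le (by gcongr)
    have hy0 : 0 < ‖y‖ := by
      rcases (norm_nonneg y).eq_or_lt with h0 | h0
      · rw [← h0] at h3; simp at h3
      · exact h0
    rw [← mul_assoc] at h3
    have h4 := lt_of_mul_lt_mul_right h3 hy0.le
    rw [inv_mul_eq_div, lt_div_iff₀ hvn] at h4
    exact h4.le
  have h5 : ‖x‖ * ‖x‖ ≤ ‖v‖ * ‖u‖ := by
    have e : (inner ℂ v u : ℂ) = inner ℂ x x := by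
      rw [hv, ContinuousLinearMap.adjoint_inner_left]
    have := norm_inner_le_norm (𝕜 := ℂ) v u
    rw [e, inner_self_eq_norm_sq_to_K, norm_pow] at this
    simpa [sq] using this
  rw [inv_mul_eq_div, le_div_iff₀ hδ]
  rcases (norm_nonneg x).eq_or_lt with h0 | h0
  · rw [← h0, zero_mul]; exact norm_nonneg _
  have h6 : (‖x‖ * δ) * ‖x‖ ≤ ‖u‖ * ‖x‖ := by
    nlinarith [norm_nonneg u, norm_nonneg v]
  exact le_of_mul_le_mul_right h6 h0

theorem disc_bound {E : Type*} [NormedAddCommGroup E] [InnerProductSpace ℂ E]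
    [FiniteDimensional ℂ E]
    (S : E →ₗ[ℂ] E) (lam : ℂ) (r : ℝ) (hr : 0 < r) (δ : ℝ) (hδ : 0 < δ)
    (hne : ∀ w, dist w lam ≤ r → ¬ Module.End.HasEigenvalue S w)
    (hs : ∀ w, dist w lam = r → ∀ v : E, ‖v‖ = 1 → ∃ y : E,
      δ * ‖y‖ < ‖(inner ℂ v (S y - w • y) : ℂ)‖) (w : ℂ) (hw : dist w lam ≤ r) (y : E) :
    δ * ‖y‖ ≤ ‖S y - w • y‖ := by
  have _ : CompleteSpace E := FiniteDimensional.complete ℂ E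
  set a : E →L[ℂ] E := LinearMap.toContinuousLinearMap S with ha
  have hap : ∀ w y, (algebraMap ℂ (E →L[ℂ] E) w - a) y = -(S y - w • y) := by
    intro w y
    simp [ha, Algebra.algebraMap_eq_smul_one]
  have hunit : ∀ w, dist w lam ≤ r → IsUnit (algebraMap ℂ (E →L[ℂ] E) w - a) := by
    intro w hw
    rw [ContinuousLinearMap.isUnit_iff_bijective]
    have hinj : Function.Injective (algebraMap ℂ (E →L[ℂ] E) w - a) := by
      rw [injective_iff_map_eq_zero]
      intro y hy
      by_contra hy0
      rw [hap, neg_eq_zero, sub_eq_zero] at hy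
      exact hne w hw (Module.End.hasEigenvalue_of_hasEigenvector
        ⟨Module.End.mem_eigenspace_iff.2 hy, hy0⟩)
    exact ⟨hinj, (LinearMap.injective_iff_surjective
      (f := (algebraMap ℂ (E →L[ℂ] E) w - a).toLinearMap)).1 hinj⟩
  have hd : DifferentiableOn ℂ (resolvent a) (Metric.closedBall lam r) := by
    intro w hw
    exact (spectrum.hasDerivAt_resolvent (hunit w hw)).differentiableAt.differentiableWithinAt
  have hcl : closure (Metric.ball lam r) = Metric.closedBall lam r := closure_ball lam hr.ne'
  have hb : ‖resolvent a w‖ ≤ δ⁻¹ := by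
    refine Complex.norm_le_of_forall_mem_frontier_norm_le (U := Metric.ball lam r)
      Metric.isBounded_ball (DifferentiableOn.diffContOnCl (by rwa [hcl])) ?_ (by rwa [hcl])
    intro z hz
    rw [frontier_ball lam hr.ne'] at hz
    refine inverse_bound _ (hunit z (le_of_eq hz)) δ hδ fun v hv => ?_
    obtain ⟨y, hy⟩ := hs z hz v hv
    refine ⟨y, ?_⟩
    rwa [hap, inner_neg_right, norm_neg]
  have hBA := Ring.inverse_mul_cancel _ (hunit w hw)
  have h1 : resolvent a w ((algebraMap ℂ (E →L[ℂ] E) w - a) y) = y :=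
    congrArg (fun f : E →L[ℂ] E => f y) hBA
  have h2 := (resolvent a w).le_of_opNorm_le hb ((algebraMap ℂ (E →L[ℂ] E) w - a) y)
  rw [h1, hap, norm_neg, inv_mul_eq_div, le_div_iff₀ hδ] at h2
  linarith

theorem resolvent_perturb (T : H →ₗ.[ℂ] H) (w lam : ℂ) (δ : ℝ) (hδ : 0 < δ)
    (hw : w ∈ resolventSetP T) (hb : ∀ x : T.domain, δ * ‖(x : H)‖ ≤ ‖T x - w • (x : H)‖)
    (hd : dist w lam < δ) : lam ∈ resolventSetP T := by
  obtain ⟨R, hR1, hR2⟩ := hw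
  have hRn : ‖R‖ ≤ δ⁻¹ := by
    refine ContinuousLinearMap.opNorm_le_bound _ (inv_nonneg.2 hδ.le) fun y => ?_
    obtain ⟨x, hx1, hx2⟩ := hR2 y
    have := hb x
    rw [hx2, hx1] at this
    rw [inv_mul_eq_div, le_div_iff₀ hδ]
    linarith
  have hlt : ‖(lam - w) • R‖ < 1 := by
    rw [norm_smul]
    rw [dist_comm, dist_eq_norm] at hd
    calc ‖lam - w‖ * ‖R‖ ≤ ‖lam - w‖ * δ⁻¹ := by gcongr
      _ < δ * δ⁻¹ := by gcongr
      _ = 1 := mul_inv_cancel₀ hδ.ne'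
  set U := Units.oneSub ((lam - w) • R) hlt with hU
  have hUv : ∀ y, (U : H →L[ℂ] H) y = y - (lam - w) • R y := fun y => by
    simp [hU]
  have hUi : ∀ y, (↑U⁻¹ : H →L[ℂ] H) ((U : H →L[ℂ] H) y) = y := fun y =>
    congrArg (fun f : H →L[ℂ] H => f y) U.inv_mul
  have hUi' : ∀ y, (U : H →L[ℂ] H) ((↑U⁻¹ : H →L[ℂ] H) y) = y := fun y =>
    congrArg (fun f : H →L[ℂ] H => f y) U.mul_inv
  refine ⟨R * (↑U⁻¹ : H →L[ℂ] H), fun x => ?_, fun y => ?_⟩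
  · have e : T x - lam • (x : H) = (U : H →L[ℂ] H) (T x - w • (x : H)) := by
      rw [hUv, hR1, sub_smul]; abel
    rw [e, ContinuousLinearMap.mul_apply, hUi, hR1]
  · obtain ⟨x, hx1, hx2⟩ := hR2 ((↑U⁻¹ : H →L[ℂ] H) y)
    refine ⟨x, hx1, ?_⟩
    have e := hUi' y
    rw [hUv, ← hx1, ← hx2] at e
    rw [← e, sub_smul]; abel

theorem isolated_approx [TopologicalSpace.SeparableSpace H] (T : H →ₗ.[ℂ] H)
    (Hn : ℕ → Submodule ℂ H) (hfd : ∀ n, FiniteDimensional ℂ ↥(Hn n))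
    (hle : ∀ n, Hn n ≤ T.domain) (hA : Approx T Hn hfd hle)
    (lam : ℂ) (hlam : lam ∉ resolventSetP T)
    (hiso : ∃ ε : ℝ, 0 < ε ∧ ∀ z : ℂ, z ≠ lam → dist z lam < ε → z ∈ resolventSetP T)
    (hess : lam ∉ essNumRange T) :
    ∃ φ : ℕ → ℕ, StrictMono φ ∧ ∃ μ : ℕ → ℂ,
        (∀ k, Module.End.HasEigenvalue
          (compressFD T (Hn (φ k)) (hfd (φ k)) (hle (φ k))) (μ k)) ∧
        Tendsto μ atTop (nhds lam) := by
  by_cases hfreq : ∀ k : ℕ, ∃ᶠ n in atTop, ∃ w, dist w lam < 1 / ((k : ℝ) + 1) ∧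
      Module.End.HasEigenvalue (compressFD T (Hn n) (hfd n) (hle n)) w
  · obtain ⟨φ, hφ, h⟩ := Filter.extraction_forall_of_frequently hfreq
    choose μ hμ1 hμ2 using h
    refine ⟨φ, hφ, μ, hμ2, ?_⟩
    rw [tendsto_iff_dist_tendsto_zero]
    exact squeeze_zero (fun _ => dist_nonneg) (fun k => (hμ1 k).le)
      tendsto_one_div_add_atTop_nhds_zero_nat
  exfalso
  push Not at hfreq
  obtain ⟨k, hk⟩ := hfreq
  obtain ⟨ε₁, hε₁, h1⟩ := hiso
  obtain ⟨ε₂, hε₂, h2⟩ := essNumRange_compl_nhds T lam hess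
  have hε₃ : 0 < 1 / ((k : ℝ) + 1) := Nat.one_div_pos_of_nat
  obtain ⟨r, hr, hrlt⟩ := exists_between (lt_min hε₁ (lt_min hε₂ hε₃))
  obtain ⟨hr1, hr2, hr3⟩ : r < ε₁ ∧ r < ε₂ ∧ r < 1 / ((k : ℝ) + 1) := by
    simpa [lt_min_iff] using hrlt
  -- uniform bound on the sphere
  have hsph : ∃ δ > 0, ∀ᶠ n in atTop, ∀ w ∈ Metric.sphere lam r, ∀ v : Hn n, ‖(v : H)‖ = 1 →
      ∃ y : Hn n, δ * ‖(y : H)‖ < ‖(inner ℂ (v : H)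
      ((compressFD T (Hn n) (hfd _) (hle _) y - w • y : Hn n) : H) : ℂ)‖ := by
    refine (isCompact_sphere lam r).induction_on
      (p := fun s => ∃ δ > 0, ∀ᶠ n in atTop, ∀ w ∈ s, ∀ v : Hn n, ‖(v : H)‖ = 1 →
      ∃ y : Hn n, δ * ‖(y : H)‖ < ‖(inner ℂ (v : H)
      ((compressFD T (Hn n) (hfd _) (hle _) y - w • y : Hn n) : H) : ℂ)‖) ?_ ?_ ?_ ?_
    · exact ⟨1, one_pos, by simp⟩
    · rintro s t hst ⟨δ, hδ, h⟩
      exact ⟨δ, hδ, h.mono fun n hn w hw => hn w (hst hw)⟩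
    · rintro s t ⟨δ, hδ, h⟩ ⟨δ', hδ', h'⟩
      refine ⟨min δ δ', lt_min hδ hδ', ?_⟩
      filter_upwards [h, h'] with n hn hn' w hw v hv
      rcases hw with hw | hw
      · obtain ⟨y, hy⟩ := hn w hw v hv
        exact ⟨y, lt_of_le_of_lt (by gcongr; exact min_le_left _ _) hy⟩
      · obtain ⟨y, hy⟩ := hn' w hw v hv
        exact ⟨y, lt_of_le_of_lt (by gcongr; exact min_le_right _ _) hy⟩
    · intro z hz
      have hz' : dist z lam = r := hz
      have hzne : z ≠ lam := by
        rintro rfl; rw [dist_self] at hz'; exact hr.ne hz'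
      obtain ⟨N, δ, hδ, h⟩ := local_bound T Hn hfd hle hA z (h1 z hzne (by rw [hz']; exact hr1))
        (h2 z (by rw [hz']; exact hr2))
      refine ⟨Metric.ball z δ, mem_nhdsWithin_of_mem_nhds (Metric.ball_mem_nhds z hδ), δ, hδ, ?_⟩
      filter_upwards [eventually_ge_atTop N] with n hn w hw
      exact h n hn w hw
  obtain ⟨δ, hδ, hsph⟩ := hsph
  have hdisc : ∀ᶠ n in atTop, ∀ w, dist w lam ≤ r → ∀ y : Hn n,
      δ * ‖(y : H)‖ ≤ ‖((compressFD T (Hn n) (hfd _) (hle _) y - w • y : Hn n) : H)‖ := by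
    filter_upwards [hsph, hk] with n hn hkn w hw y
    have _ := hfd n
    exact disc_bound (compressFD T (Hn n) (hfd _) (hle _)) lam r hr δ hδ
      (fun z hz => hkn z (hz.trans_lt hr3)) hn w hw y
  have hT : ∀ w, dist w lam ≤ r → ∀ x : T.domain, δ * ‖(x : H)‖ ≤ ‖T x - w • (x : H)‖ := by
    intro w hw x
    obtain ⟨y, hy1, hy2⟩ := hA x
    refine le_of_tendsto_of_tendsto (hy1.norm.const_mul δ) (hy2.sub (hy1.const_smul w)).norm ?_
    filter_upwards [hdisc] with n hn
    exact hn w hw (y n)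
  obtain ⟨s, hs0, hs⟩ := exists_between (lt_min hr hδ)
  obtain ⟨hsr, hsδ⟩ := lt_min_iff.1 hs
  have hdist : dist (lam + (s : ℂ)) lam = s := by
    rw [dist_eq_norm, add_sub_cancel_left, Complex.norm_real, Real.norm_of_nonneg hs0.le]
  have hwne : lam + (s : ℂ) ≠ lam := by
    intro h
    rw [h, dist_self] at hdist
    exact hs0.ne hdist
  exact hlam (resolvent_perturb T (lam + s) lam δ hδ (h1 _ hwne (by rw [hdist]; linarith))
    (hT _ (by rw [hdist]; exact hsr.le)) (by rw [hdist]; exact hsδ))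

/-- Theorem 6.1: for the projection method onto finite-dimensional subspaces
`H_n ⊆ dom T` with `P_{H_n} →s I` and `T_{H_n} →gsr T`: (i) the limiting essential
numerical range of the compressions equals `W_e(T)`; (ii) spectral pollution is confined
to `W_e(T)`; (iii) every isolated point of `σ(T)` outside `W_e(T)` is approximated. -/
theorem projection_method_essNumRange
    [TopologicalSpace.SeparableSpace H] (hinf : ¬FiniteDimensional ℂ H)
    (T : H →ₗ.[ℂ] H) (hdense : Dense (T.domain : Set H))
    (Hn : ℕ → Submodule ℂ H) (hfd : ∀ n, FiniteDimensional ℂ ↥(Hn n))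
    (hle : ∀ n, Hn n ≤ T.domain)
    (hP : ∀ x : H, Tendsto (fun n => ((projFD (Hn n) (hfd n) x : ↥(Hn n)) : H))
      atTop (nhds x))
    (hgsr : GSRcompress T Hn hfd hle) :
    limEssNumRangeC Hn (fun n => compressFD T (Hn n) (hfd n) (hle n)) = essNumRange T ∧
    (∀ lam : ℂ, lam ∈ resolventSetP T →
      (∃ φ : ℕ → ℕ, StrictMono φ ∧ ∃ μ : ℕ → ℂ,
        (∀ k, Module.End.HasEigenvalue
          (compressFD T (Hn (φ k)) (hfd (φ k)) (hle (φ k))) (μ k)) ∧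
        Tendsto μ atTop (nhds lam)) →
      lam ∈ essNumRange T) ∧
    (∀ lam : ℂ, lam ∉ resolventSetP T →
      (∃ ε : ℝ, 0 < ε ∧ ∀ z : ℂ, z ≠ lam → dist z lam < ε → z ∈ resolventSetP T) →
      lam ∉ essNumRange T →
      ∃ φ : ℕ → ℕ, StrictMono φ ∧ ∃ μ : ℕ → ℂ,
        (∀ k, Module.End.HasEigenvalue
          (compressFD T (Hn (φ k)) (hfd (φ k)) (hle (φ k))) (μ k)) ∧
        Tendsto μ atTop (nhds lam)) := by
  have hA := approx_of_gsr T Hn hfd hle hP hgsr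
  refine ⟨limEss_eq T Hn hfd hle hA, ?_, ?_⟩
  · rintro lam hlam ⟨φ, hφ, μ, hev, hμ⟩
    exact pollution T Hn hfd hle hA lam hlam φ hφ.tendsto_atTop μ hμ hev
  · intro lam h1 h2 h3
    exact isolated_approx T Hn hfd hle hA lam h1 h2 h3
end
end

section
/- Let T be a densely defined linear operator in H and let λ ∈ W_e(T). Then there exist finite-dimensional subspaces H_n ⊆ dom(T), n ∈ ℕ, with H_n ≠ {0}, such that P_{H_n} →s I and there are eigenvalues μ_n ∈ σ(T_{H_n}) of the compressions T_{H_n} := P_{H_n} T|_{H_n} with μ_n → λ as n → ∞. -/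
open Filter Topology

noncomputable section

variable {H : Type*} [NormedAddCommGroup H] [InnerProductSpace ℂ H] [CompleteSpace H]

/-- A monic complex polynomial which is small at `z` has a root close to `z`. -/
lemma exists_root_near (p : Polynomial ℂ) (hp : p.Monic) (z : ℂ) (ε : ℝ) (hε : 0 < ε)
    (h : ‖p.eval z‖ < ε ^ p.natDegree) : ∃ w, p.IsRoot w ∧ ‖w - z‖ < ε := by
  by_contra! hcon
  have hs : p.Splits := IsAlgClosed.splits p
  have hr : ∀ w ∈ p.roots, ε ≤ ‖z - w‖ := by
    intro w hw
    rw [norm_sub_rev]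
    exact hcon w ((Polynomial.mem_roots'.1 hw).2)
  rw [hs.eval_eq_prod_roots_of_monic hp, hs.natDegree_eq_card_roots] at h
  have key : ∀ s : Multiset ℂ, (∀ w ∈ s, ε ≤ ‖z - w‖) →
      ε ^ s.card ≤ ‖(s.map (z - ·)).prod‖ := by
    intro s
    induction s using Multiset.induction_on with
    | empty => intro _; simp
    | cons a s ih =>
      intro hs
      have h1 := ih (fun w hw => hs w (Multiset.mem_cons_of_mem hw))
      have h2 := hs a (Multiset.mem_cons_self a s)
      simp only [Multiset.card_cons, Multiset.map_cons, Multiset.prod_cons, norm_mul, pow_succ]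
      rw [mul_comm]
      gcongr
  exact absurd h (not_lt.2 (key _ hr))

/-- If the pencil `(K, Γ)` has generalized eigenvalue `μ`, so does the compression. -/
lemma compress_eigenvalue (T : H →ₗ.[ℂ] H) {ι : Type*} [Fintype ι] [DecidableEq ι]
    (v : ι → T.domain) (M : Submodule ℂ H) (hM : M = Submodule.span ℂ (Set.range fun i => (v i : H)))
    (hfd : FiniteDimensional ℂ ↥M) (hle : M ≤ T.domain)
    (Γ K : Matrix ι ι ℂ) (hΓ : ∀ i j, Γ i j = inner ℂ (v i : H) (v j : H))
    (hK : ∀ i j, K i j = inner ℂ (v i : H) (T (v j))) (hdet : Γ.det ≠ 0)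
    (μ : ℂ) (c : ι → ℂ) (hc : c ≠ 0) (h : K.mulVec c = μ • Γ.mulVec c) :
    Module.End.HasEigenvalue (compressFD T M hfd hle) μ := by
  set z : T.domain := ∑ j, c j • v j with hz
  have hzH : (z : H) = ∑ j, c j • (v j : H) := by simp [hz]
  have hTz : T z = ∑ j, c j • T (v j) := by
    rw [hz]
    change T.toFun _ = _
    simp only [map_sum, map_smul]
    rfl
  have hG : ∀ i, inner ℂ (v i : H) (z : H) = Γ.mulVec c i := by
    intro i
    simp [hzH, inner_sum, inner_smul_right, Matrix.mulVec, dotProduct, hΓ, mul_comm]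
  have hKz : ∀ i, inner ℂ (v i : H) (T z) = K.mulVec c i := by
    intro i
    simp [hTz, inner_sum, inner_smul_right, Matrix.mulVec, dotProduct, hK, mul_comm]
  have hzM : (z : H) ∈ M := by
    rw [hzH, hM]
    exact Submodule.sum_mem _ fun j _ => Submodule.smul_mem _ _ (Submodule.subset_span ⟨j, rfl⟩)
  have hz0 : (z : H) ≠ 0 := by
    intro h0
    apply hc
    apply Matrix.eq_zero_of_mulVec_eq_zero hdet
    ext i
    rw [← hG i, h0]; simp
  have horth : ∀ w ∈ M, inner ℂ (T z - μ • (z : H)) w = 0 := by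
    intro w hw
    rw [hM] at hw
    induction hw using Submodule.span_induction with
    | mem x hx =>
      obtain ⟨i, rfl⟩ := hx
      rw [← inner_conj_symm, inner_sub_right, inner_smul_right, hG, hKz, h]
      simp
    | zero => simp
    | add x y _ _ hx hy => rw [inner_add_right, hx, hy, add_zero]
    | smul a x _ hx => rw [inner_smul_right, hx, mul_zero]
  apply Module.End.hasEigenvalue_of_hasEigenvector (x := (⟨z, hzM⟩ : M))
  rw [Module.End.hasEigenvector_iff]
  refine ⟨?_, fun h0 => hz0 (congrArg Subtype.val h0)⟩
  rw [Module.End.mem_eigenspace_iff]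
  apply Subtype.ext
  have : (Submodule.inclusion hle ⟨z, hzM⟩ : T.domain) = z := rfl
  change (M.starProjection (T (Submodule.inclusion hle ⟨z, hzM⟩)) : H) = μ • (z : H)
  rw [this]
  exact Submodule.eq_starProjection_of_mem_of_inner_eq_zero (M.smul_mem _ hzM) horth

/-- Convergence of pencils gives convergence of an eigenvalue. -/
lemma eigenvalue_of_tendsto (T : H →ₗ.[ℂ] H) {ι : Type*} [Fintype ι] [DecidableEq ι]
    [Nonempty ι]
    (v : ℕ → ι → T.domain) (L : Matrix ι ι ℂ) (lam : ℂ)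
    (hΓ : ∀ i j, Tendsto (fun n => inner ℂ (v n i : H) (v n j : H)) atTop
      (𝓝 ((1 : Matrix ι ι ℂ) i j)))
    (hK : ∀ i j, Tendsto (fun n => inner ℂ (v n i : H) (T (v n j))) atTop (𝓝 (L i j)))
    (hL : (Matrix.scalar ι lam - L).det = 0) (ε : ℝ) (hε : 0 < ε) :
    ∀ᶠ n in atTop, ∃ μ : ℂ, ‖μ - lam‖ < ε ∧
      ∀ (M : Submodule ℂ H) (_ : M = Submodule.span ℂ (Set.range fun i => (v n i : H)))
        (hfd : FiniteDimensional ℂ ↥M) (hle : M ≤ T.domain),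
        Module.End.HasEigenvalue (compressFD T M hfd hle) μ := by
  set Γ : ℕ → Matrix ι ι ℂ := fun n => Matrix.of fun i j => inner ℂ (v n i : H) (v n j : H) with hΓd
  set K : ℕ → Matrix ι ι ℂ := fun n => Matrix.of fun i j => inner ℂ (v n i : H) (T (v n j)) with hKd
  have hΓt : Tendsto Γ atTop (𝓝 1) := by
    exact tendsto_pi_nhds.2 fun i => tendsto_pi_nhds.2 fun j => hΓ i j
  have hKt : Tendsto K atTop (𝓝 L) := by
    exact tendsto_pi_nhds.2 fun i => tendsto_pi_nhds.2 fun j => hK i j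
  have hdet : Continuous (fun A : Matrix ι ι ℂ => A.det) := continuous_id.matrix_det
  have hd1 : Tendsto (fun n => (Γ n).det) atTop (𝓝 1) := by
    have := (hdet.tendsto 1).comp hΓt
    simpa [Function.comp_def] using this
  have hd2 : Tendsto (fun n => (lam • Γ n - K n).det) atTop (𝓝 0) := by
    have h1 : Tendsto (fun n => lam • Γ n - K n) atTop (𝓝 (lam • 1 - L)) :=
      (hΓt.const_smul lam).sub hKt
    have := (hdet.tendsto _).comp h1
    have h2 : (lam • (1 : Matrix ι ι ℂ) - L).det = 0 := by
      rw [← hL]; congr 2; ext i j; simp [Matrix.scalar_apply, Matrix.diagonal_apply, Matrix.one_apply]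
    rw [h2] at this
    exact this
  have hq : Tendsto (fun n => ‖(lam • Γ n - K n).det / (Γ n).det‖) atTop (𝓝 0) := by
    have := (hd2.div hd1 one_ne_zero).norm
    simpa using this
  have hpow : 0 < ε ^ Fintype.card ι := by positivity
  filter_upwards [hq.eventually_lt_const hpow, hd1.eventually_ne one_ne_zero] with n hn hne
  have hunit : IsUnit (Γ n).det := isUnit_iff_ne_zero.2 hne
  set X := (Γ n)⁻¹ * K n with hX
  have hΓX : Γ n * X = K n := by rw [hX, Matrix.mul_nonsing_inv_cancel_left _ _ hunit]
  have heval : X.charpoly.eval lam = (lam • Γ n - K n).det / (Γ n).det := by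
    rw [Matrix.eval_charpoly, eq_div_iff hne, mul_comm, ← Matrix.det_mul, Matrix.mul_sub, hΓX]
    congr 2
    ext i j; simp [Matrix.scalar_apply, mul_comm]
  obtain ⟨μ, hroot, hμ⟩ := exists_root_near X.charpoly X.charpoly_monic lam ε hε (by
    rw [heval, Matrix.charpoly_natDegree_eq_dim]; exact hn)
  refine ⟨μ, hμ, fun M hM hfd hle => ?_⟩
  have h0 : (Matrix.scalar ι μ - X).det = 0 := by
    rw [← Matrix.eval_charpoly]; exact hroot
  obtain ⟨c, hc, hcX⟩ := Matrix.exists_mulVec_eq_zero_iff.2 h0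
  refine compress_eigenvalue T (v n) M hM hfd hle (Γ n) (K n) (fun _ _ => rfl) (fun _ _ => rfl)
    hne μ c hc ?_
  rw [Matrix.sub_mulVec, sub_eq_zero] at hcX
  rw [← hΓX, ← Matrix.mulVec_mulVec, ← hcX, ← Matrix.mulVec_smul]
  congr 1
  ext i; simp [Matrix.scalar_apply, Matrix.mulVec_diagonal]

/-- Key step: an arbitrary finite-dimensional subspace of the domain can be approximated by one
whose compression has an eigenvalue close to `lam`. -/
lemma exists_approx_subspace (T : H →ₗ.[ℂ] H) (lam : ℂ) (hlam : lam ∈ essNumRange T)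
    (G : Submodule ℂ H) (hG : FiniteDimensional ℂ G) (hGT : G ≤ T.domain) (ε : ℝ) (hε : 0 < ε) :
    ∃ (M : Submodule ℂ H) (hfd : FiniteDimensional ℂ ↥M) (hle : M ≤ T.domain),
      (∀ g ∈ G, ∃ x ∈ M, ‖g - x‖ ≤ ε * ‖g‖) ∧
      ∃ μ : ℂ, ‖μ - lam‖ < ε ∧ Module.End.HasEigenvalue (compressFD T M hfd hle) μ := by
  obtain ⟨x, hx1, hxw, hxT⟩ := hlam
  set b := stdOrthonormalBasis ℂ G with hb
  set k := Module.finrank ℂ G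
  set m : Fin k → T.domain := fun i => ⟨(b i : H), hGT (b i).2⟩ with hm
  have hmo : ∀ i j, inner ℂ (m i : H) (m j : H) = (1 : Matrix (Fin k) (Fin k) ℂ) i j := by
    intro i j
    have := orthonormal_iff_ite.1 b.orthonormal i j
    rw [Matrix.one_apply]
    exact this
  have hgsum : ∀ g ∈ G, g = ∑ i, (inner ℂ (m i : H) g : ℂ) • (m i : H) := by
    intro g hg
    have := b.sum_repr' ⟨g, hg⟩
    have := congrArg Subtype.val this
    simp only [Submodule.coe_sum, Submodule.coe_smul] at this
    exact this.symm
  have hmn : ∀ i, ‖(m i : H)‖ = 1 := fun i => b.orthonormal.1 i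
  have hspan : ∀ (ι : Type) [Fintype ι] (v : ι → T.domain),
      Submodule.span ℂ (Set.range fun i => (v i : H)) ≤ T.domain := by
    intro ι _ v
    rw [Submodule.span_le]
    rintro _ ⟨i, rfl⟩
    exact (v i).2
  set q : ℕ → Fin k → ℂ := fun n i => inner ℂ (m i : H) (T (x n)) with hq
  have hxw' : ∀ y : H, Tendsto (fun n => inner ℂ y (x n : H)) atTop (𝓝 0) := by
    intro y
    have := (Complex.continuous_conj.tendsto 0).comp (hxw y)
    simp only [map_zero] at this
    refine this.congr fun n => ?_
    simp [inner_conj_symm]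
  by_cases hcase : Tendsto (fun n => ‖q n‖) atTop atTop
  · -- unbounded case
    have hsph : ∀ᶠ n in atTop, ((‖q n‖⁻¹ : ℝ) : ℂ) • q n ∈ Metric.sphere (0 : Fin k → ℂ) 1 := by
      filter_upwards [hcase.eventually_gt_atTop 0] with n hn
      rw [mem_sphere_zero_iff_norm, norm_smul]
      simp [hn.ne']
    obtain ⟨p, hp, φ, hφ, hpt⟩ := (isCompact_sphere (0 : Fin k → ℂ) 1).tendsto_subseq'
      hsph.frequently
    have hp1 : ‖p‖ = 1 := by simpa using hp
    have hp0 : p ≠ 0 := by rintro rfl; simp at hp1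
    have hNe : Nonempty (Fin k) := by
      by_contra hne
      rw [not_nonempty_iff] at hne
      exact hp0 (Subsingleton.elim _ _)
    set s : ℕ → ℂ := fun n => ((‖q (φ n)‖⁻¹ : ℝ) : ℂ) with hs
    have hs0 : Tendsto s atTop (𝓝 0) := by
      have h1 : Tendsto (fun n => ‖q (φ n)‖⁻¹) atTop (𝓝 0) :=
        (tendsto_inv_atTop_zero.comp hcase).comp hφ.tendsto_atTop
      have := (Complex.continuous_ofReal.tendsto 0).comp h1
      simpa [Function.comp_def, hs] using this
    set y : ℕ → T.domain := fun n => s n • x (φ n) with hy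
    have hTy : ∀ n, T (y n) = s n • T (x (φ n)) := fun n => T.map_smul _ _
    have hy0 : Tendsto (fun n => (y n : H)) atTop (𝓝 0) := by
      rw [tendsto_zero_iff_norm_tendsto_zero]
      have : ∀ n, ‖(y n : H)‖ = ‖s n‖ := by intro n; simp [hy, norm_smul, hx1]
      simp only [this]
      simpa using hs0.norm
    have hmy : ∀ i, Tendsto (fun n => inner ℂ (m i : H) (T (y n))) atTop (𝓝 (p i)) := by
      intro i
      refine (tendsto_pi_nhds.1 hpt i).congr fun n => ?_
      simp [hTy, inner_smul_right, hq, hs]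
    have hyy : Tendsto (fun n => inner ℂ (y n : H) (T (y n))) atTop (𝓝 0) := by
      have h1 := (((Complex.continuous_conj.tendsto 0).comp hs0).mul hs0).mul
        (hxT.comp hφ.tendsto_atTop)
      simp only [map_zero, zero_mul] at h1
      refine h1.congr fun n => ?_
      rw [hTy]
      simp [hy, inner_smul_right, inner_smul_left]
      ring
    have hym : ∀ u : H, Tendsto (fun n => inner ℂ (y n : H) u) atTop (𝓝 0) := by
      intro u
      simpa using hy0.inner (tendsto_const_nhds (x := u))
    set A : Matrix (Fin k) (Fin k) ℂ := Matrix.of fun i j => inner ℂ (m i : H) (T (m j)) with hA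
    obtain ⟨α, hα⟩ : ∃ α : Fin k → ℂ,
        (Matrix.scalar (Fin k) lam - (A + Matrix.vecMulVec p α)).det = 0 := by
      by_cases hdet : (Matrix.scalar (Fin k) lam - A).det = 0
      · refine ⟨0, ?_⟩
        simpa using hdet
      · set B := Matrix.scalar (Fin k) lam - A with hB
        have hu : IsUnit B.det := isUnit_iff_ne_zero.2 hdet
        set c := B⁻¹.mulVec p with hc
        have hBc : B.mulVec c = p := by
          rw [hc, Matrix.mulVec_mulVec, Matrix.mul_nonsing_inv _ hu, Matrix.one_mulVec]
        have hc0 : c ≠ 0 := by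
          intro h0; rw [h0, Matrix.mulVec_zero] at hBc; exact hp0 hBc.symm
        obtain ⟨i, hi⟩ := Function.ne_iff.1 hc0
        refine ⟨Pi.single i (c i)⁻¹, Matrix.exists_mulVec_eq_zero_iff.1 ⟨c, hc0, ?_⟩⟩
        rw [← sub_sub, ← hB, Matrix.sub_mulVec, hBc, Matrix.vecMulVec_mulVec]
        have hi' : c i ≠ 0 := hi
        ext j
        simp [hi']
    set v : ℕ → Fin k → T.domain := fun n i => m i + α i • y n with hv
    have hvt : ∀ i, Tendsto (fun n => (v n i : H)) atTop (𝓝 (m i : H)) := by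
      intro i
      have := (hy0.const_smul (α i)).const_add (m i : H)
      simpa [hv] using this
    have hev := eigenvalue_of_tendsto T v (A + Matrix.vecMulVec p α) lam
      (fun i j => by rw [← hmo]; exact (hvt i).inner (hvt j))
      (fun i j => by
        have hT : ∀ n, T (v n j) = T (m j) + α j • T (y n) := by
          intro n; rw [hv, T.map_add, T.map_smul]
        have h1 := (((tendsto_const_nhds (x := A i j)).add ((hmy i).const_mul (α j))).add
          ((hym (T (m j))).const_mul (starRingEnd ℂ (α i)))).add
          (hyy.const_mul (starRingEnd ℂ (α i) * α j))
        have h2 : A i j + α j * p i + starRingEnd ℂ (α i) * 0 + starRingEnd ℂ (α i) * α j * 0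
          = (A + Matrix.vecMulVec p α) i j := by
          simp [Matrix.vecMulVec_apply]; ring
        rw [h2] at h1
        refine h1.congr fun n => ?_
        rw [hT]
        simp [hv, hA, inner_add_left, inner_add_right, inner_smul_left, inner_smul_right]
        ring)
      hα ε hε
    have hsm : Tendsto (fun n => (∑ i, ‖α i‖) * ‖(y n : H)‖) atTop (𝓝 0) := by
      simpa using hy0.norm.const_mul (∑ i, ‖α i‖)
    obtain ⟨n, ⟨μ, hμ, hM⟩, hn⟩ := (hev.and (hsm.eventually_lt_const hε)).exists
    refine ⟨Submodule.span ℂ (Set.range fun i => (v n i : H)),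
      FiniteDimensional.span_of_finite ℂ (Set.finite_range _), hspan _ _, ?_, μ, hμ,
      hM _ rfl _ _⟩
    intro g hg
    refine ⟨∑ i, (inner ℂ (m i : H) g : ℂ) • (v n i : H), Submodule.sum_mem _ fun j _ =>
      Submodule.smul_mem _ _ (Submodule.subset_span ⟨j, rfl⟩), ?_⟩
    have hdiff : g - ∑ i, (inner ℂ (m i : H) g : ℂ) • (v n i : H)
        = - ∑ i, (inner ℂ (m i : H) g : ℂ) • α i • (y n : H) := by
      conv_lhs => rw [hgsum g hg]
      rw [← hgsum g hg]
      simp only [hv, Submodule.coe_add, Submodule.coe_smul, smul_add, Finset.sum_add_distrib]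
      rw [← hgsum g hg]
      abel
    rw [hdiff, norm_neg]
    calc ‖∑ i, (inner ℂ (m i : H) g : ℂ) • α i • (y n : H)‖
        ≤ ∑ i, ‖g‖ * (‖α i‖ * ‖(y n : H)‖) := by
          refine norm_sum_le_of_le _ fun i _ => ?_
          rw [norm_smul, norm_smul]
          gcongr
          have := norm_inner_le_norm (𝕜 := ℂ) (m i : H) g
          rwa [hmn, one_mul] at this
      _ = ((∑ i, ‖α i‖) * ‖(y n : H)‖) * ‖g‖ := by
          rw [← Finset.mul_sum, ← Finset.sum_mul]; ring
      _ ≤ ε * ‖g‖ := by gcongr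
  · -- bounded case
    obtain ⟨R, hR⟩ : ∃ R : ℝ, ∃ᶠ n in atTop, q n ∈ Metric.closedBall (0 : Fin k → ℂ) R := by
      rw [tendsto_atTop] at hcase
      push Not at hcase
      obtain ⟨R, hR⟩ := hcase
      refine ⟨R, hR.mono fun n hn => ?_⟩
      rw [mem_closedBall_zero_iff]
      exact (le_of_lt (by simpa using hn))
    obtain ⟨p, -, φ, hφ, hpt⟩ := (isCompact_closedBall (0 : Fin k → ℂ) R).tendsto_subseq' hR
    set v : ℕ → (Fin k ⊕ Unit) → T.domain := fun n => Sum.elim m (fun _ => x (φ n)) with hv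
    set L : Matrix (Fin k ⊕ Unit) (Fin k ⊕ Unit) ℂ := Matrix.fromBlocks
      (Matrix.of fun i j => inner ℂ (m i : H) (T (m j))) (Matrix.of fun i _ => p i)
      0 (Matrix.of fun _ _ => lam) with hL
    have hev := eigenvalue_of_tendsto T v L lam
      (fun i j => by
        rcases i with i | i <;> rcases j with j | j
        · have := hmo i j
          simp only [hv, Sum.elim_inl]
          rw [this]
          simp [Matrix.one_apply]
        · simpa [hv, Function.comp_def] using (hxw' (m i)).comp hφ.tendsto_atTop
        · simpa [hv, Function.comp_def] using (hxw (m j)).comp hφ.tendsto_atTop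
        · simp [hv, hx1, inner_self_eq_norm_sq_to_K])
      (fun i j => by
        rcases i with i | i <;> rcases j with j | j
        · simp [hv, hL]
        · simpa [hv, hL] using tendsto_pi_nhds.1 hpt i
        · simpa [hv, hL, Function.comp_def] using (hxw (T (m j))).comp hφ.tendsto_atTop
        · simpa [hv, hL, Function.comp_def] using hxT.comp hφ.tendsto_atTop)
      (by
        apply Matrix.det_eq_zero_of_row_eq_zero (Sum.inr ())
        rintro (j | j) <;> simp [hL, Matrix.scalar_apply, Matrix.diagonal_apply])
      ε hε
    obtain ⟨n, μ, hμ, hM⟩ := hev.exists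
    refine ⟨Submodule.span ℂ (Set.range fun i => (v n i : H)),
      FiniteDimensional.span_of_finite ℂ (Set.finite_range _), hspan _ _, ?_, μ, hμ,
      hM _ rfl _ _⟩
    intro g hg
    refine ⟨g, ?_, by simp; positivity⟩
    rw [hgsum g hg]
    exact Submodule.sum_mem _ fun j _ =>
      Submodule.smul_mem _ _ (Submodule.subset_span ⟨Sum.inl j, rfl⟩)

/-- Theorem 6.3: for a densely defined operator `T` and any `λ ∈ W_e(T)` there are
finite-dimensional subspaces `H_n ⊆ dom T` with `P_{H_n} →s I` and eigenvalues
`μ_n ∈ σ(T_{H_n})` of the compressions with `μ_n → λ`. -/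
theorem exists_projection_method_with_spurious_eigenvalue
    [TopologicalSpace.SeparableSpace H] (hinf : ¬FiniteDimensional ℂ H)
    (T : H →ₗ.[ℂ] H) (hdense : Dense (T.domain : Set H))
    (lam : ℂ) (hlam : lam ∈ essNumRange T) :
    ∃ (Hn : ℕ → Submodule ℂ H) (hfd : ∀ n, FiniteDimensional ℂ ↥(Hn n))
      (hle : ∀ n, Hn n ≤ T.domain),
      (∀ n, Hn n ≠ ⊥) ∧
      (∀ x : H, Tendsto (fun n => ((projFD (Hn n) (hfd n) x : ↥(Hn n)) : H))
        atTop (nhds x)) ∧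
      ∃ μ : ℕ → ℂ,
        (∀ n, Module.End.HasEigenvalue (compressFD T (Hn n) (hfd n) (hle n)) (μ n)) ∧
        Tendsto μ atTop (nhds lam) := by
  have hsep : TopologicalSpace.SeparableSpace T.domain := by
    have : SecondCountableTopology H := UniformSpace.secondCountable_of_separable H
    infer_instance
  set d : ℕ → T.domain := TopologicalSpace.denseSeq T.domain with hd
  set G : ℕ → Submodule ℂ H := fun n =>
    Submodule.span ℂ ((fun j => (d j : H)) '' (Set.Iic n)) with hG
  have hGfd : ∀ n, FiniteDimensional ℂ (G n) := fun n =>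
    FiniteDimensional.span_of_finite ℂ ((Set.finite_Iic n).image _)
  have hGT : ∀ n, G n ≤ T.domain := by
    intro n
    rw [hG, Submodule.span_le]
    rintro _ ⟨j, -, rfl⟩
    exact (d j).2
  have hε : ∀ n : ℕ, (0 : ℝ) < 1 / ((n : ℝ) + 1) := fun n => Nat.one_div_pos_of_nat
  choose M hfd hle happ μ hμ heig using fun n =>
    exists_approx_subspace T lam hlam (G n) (hGfd n) (hGT n) (1 / ((n : ℝ) + 1)) (hε n)
  refine ⟨M, hfd, hle, ?_, ?_, μ, heig, ?_⟩
  · intro n hbot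
    obtain ⟨z, hz⟩ := (heig n).exists_hasEigenvector
    apply hz.2
    apply Subtype.ext
    have : (z : H) ∈ (⊥ : Submodule ℂ H) := hbot ▸ z.2
    simpa using this
  · intro x
    rw [Metric.tendsto_atTop]
    intro δ hδ
    obtain ⟨y, hy, hxy⟩ := Metric.mem_closure_iff.1 (hdense x) (δ / 3) (by positivity)
    obtain ⟨_, ⟨j, rfl⟩, hj⟩ := Metric.mem_closure_iff.1
      ((TopologicalSpace.denseRange_denseSeq T.domain) ⟨y, hy⟩) (δ / 3) (by positivity)
    have hj' : dist y (d j : H) < δ / 3 := hj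
    have hlim : Tendsto (fun n : ℕ => 1 / ((n : ℝ) + 1) * ‖(d j : H)‖) atTop (𝓝 0) := by
      simpa using tendsto_one_div_add_atTop_nhds_zero_nat.mul_const ‖(d j : H)‖
    obtain ⟨N, hN⟩ := eventually_atTop.1 (hlim.eventually_lt_const (show (0 : ℝ) < δ / 3 by positivity))
    refine ⟨max N j, fun n hn => ?_⟩
    obtain ⟨w, hw, hdw⟩ := happ n (d j) (Submodule.subset_span
      ⟨j, (le_max_right N j).trans hn, rfl⟩)
    have h1 := hN n ((le_max_left N j).trans hn)
    have hfdn := hfd n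
    have h2 : ‖x - (M n).starProjection x‖ ≤ ‖x - w‖ := by
      rw [Submodule.starProjection_minimal]
      exact ciInf_le ⟨0, by rintro _ ⟨z, rfl⟩; positivity⟩ (⟨w, hw⟩ : M n)
    change dist ((M n).starProjection x) x < δ
    rw [dist_comm, dist_eq_norm]
    calc ‖x - (M n).starProjection x‖ ≤ ‖x - w‖ := h2
      _ = dist x w := (dist_eq_norm _ _).symm
      _ ≤ dist x y + dist y (d j : H) + dist (d j : H) w := dist_triangle4 _ _ _ _
      _ < δ := by
        rw [dist_eq_norm (d j : H) w]
        linarith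
  · rw [tendsto_iff_norm_sub_tendsto_zero]
    exact squeeze_zero (fun _ => norm_nonneg _) (fun n => (hμ n).le)
      tendsto_one_div_add_atTop_nhds_zero_nat
end
end
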